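/- There is no triangulation of the torus in which all vertices have degree 6 except exactly two vertices, one of degree 5 and one of degree 7. -/

import Mathlib

/-!
Combinatorial triangulated surfaces.

A triangulation is encoded by its finset of faces (each a 3-element finset of
vertices).  `IsClosedSurface` says: nonempty, every face a triangle, every edge
in exactly two faces, and the faces around each vertex are connected through
edges containing that vertex (so the link of every vertex is a single cycle).
A connected closed surface with Euler characteristic 2 is a sphere, with
Euler characteristic 1 is the projective plane, and an orientable one with
Euler characteristic 0 is the torus.  Surfaces with boundary allow edges lying
in exactly one face; a connected such surface is simply connected iff it is a
disk (Euler characteristic 1, with boundary) or a sphere (Euler characteristic 2).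
The degree of a vertex is the number of edges containing it.
-/

namespace Fisk

variable {V : Type*} [DecidableEq V]

/-- The edges of a triangulation: the 2-element subsets of its faces. -/
def edges (F : Finset (Finset V)) : Finset (Finset V) :=
  F.biUnion (fun f => f.powersetCard 2)

/-- The vertex set of a triangulation. -/
def vertices (F : Finset (Finset V)) : Finset V := F.sup id

/-- The degree of a vertex: the number of edges containing it. -/
def degree (F : Finset (Finset V)) (v : V) : ℕ :=
  ((edges F).filter (fun e => v ∈ e)).card

/-- Two vertices are adjacent if they span an edge. -/
def IsAdjacent (F : Finset (Finset V)) (a b : V) : Prop :=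
  a ≠ b ∧ ({a, b} : Finset V) ∈ edges F

/-- The faces are connected under the relation "share an edge". -/
def FacesConnected (F : Finset (Finset V)) : Prop :=
  ∀ f ∈ F, ∀ g ∈ F,
    Relation.ReflTransGen (fun x y => x ∈ F ∧ y ∈ F ∧ (x ∩ y).card = 2) f g

/-- Around every vertex, the faces containing it are connected through
edges containing it (links are connected). -/
def LinkConnected (F : Finset (Finset V)) : Prop :=
  ∀ v : V, ∀ f ∈ F, ∀ g ∈ F, v ∈ f → v ∈ g →
    Relation.ReflTransGen
      (fun x y => x ∈ F ∧ y ∈ F ∧ v ∈ x ∧ v ∈ y ∧ (x ∩ y).card = 2) f g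

/-- A triangulation of a closed surface. -/
def IsClosedSurface (F : Finset (Finset V)) : Prop :=
  F.Nonempty ∧ (∀ f ∈ F, f.card = 3) ∧
  (∀ e ∈ edges F, (F.filter (fun f => e ⊆ f)).card = 2) ∧
  LinkConnected F

/-- The Euler characteristic `#V - #E + #F`. -/
def eulerChar (F : Finset (Finset V)) : ℤ :=
  ((vertices F).card : ℤ) - ((edges F).card : ℤ) + (F.card : ℤ)

/-- A triangulation of the 2-sphere: a connected closed surface with
Euler characteristic 2. -/
def IsSphere (F : Finset (Finset V)) : Prop :=
  IsClosedSurface F ∧ FacesConnected F ∧ eulerChar F = 2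

/-- The oriented edges of an ordered triple. -/
def orientedEdges (t : V × V × V) : Finset (V × V) :=
  {(t.1, t.2.1), (t.2.1, t.2.2), (t.2.2, t.1)}

/-- Orientability: each face can be given a cyclic order of its vertices so
that no directed edge is induced by two different faces (i.e. adjacent faces
induce opposite orientations on their common edge). -/
def Orientable (F : Finset (Finset V)) : Prop :=
  ∃ o : Finset V → V × V × V,
    (∀ f ∈ F, ({(o f).1, (o f).2.1, (o f).2.2} : Finset V) = f) ∧
    (∀ f ∈ F, ∀ g ∈ F, f ≠ g → ∀ p ∈ orientedEdges (o f), p ∉ orientedEdges (o g))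

/-- A triangulation of the torus: a connected orientable closed surface with
Euler characteristic 0. -/
def IsTorus (F : Finset (Finset V)) : Prop :=
  IsClosedSurface F ∧ FacesConnected F ∧ Orientable F ∧ eulerChar F = 0

/-- A triangulation of the projective plane: a connected closed surface with
Euler characteristic 1. -/
def IsProjectivePlane (F : Finset (Finset V)) : Prop :=
  IsClosedSurface F ∧ FacesConnected F ∧ eulerChar F = 1

/-- A triangulation of a surface, possibly with boundary: every edge lies in
one or two faces. -/
def IsSurfaceWithBoundary (F : Finset (Finset V)) : Prop :=
  F.Nonempty ∧ (∀ f ∈ F, f.card = 3) ∧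
  (∀ e ∈ edges F,
    (F.filter (fun f => e ⊆ f)).card = 1 ∨ (F.filter (fun f => e ⊆ f)).card = 2) ∧
  LinkConnected F

/-- The boundary edges: edges lying in exactly one face. -/
def boundaryEdges (F : Finset (Finset V)) : Finset (Finset V) :=
  (edges F).filter (fun e => (F.filter (fun f => e ⊆ f)).card = 1)

/-- The boundary vertices: vertices of boundary edges. -/
def boundaryVertices (F : Finset (Finset V)) : Finset V :=
  (boundaryEdges F).sup id

/-- A compact connected surface (possibly with boundary) is simply connected
iff it is a sphere (χ = 2) or a disk (χ = 1, nonempty boundary). -/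
def IsSimplyConnectedSurface (F : Finset (Finset V)) : Prop :=
  IsSurfaceWithBoundary F ∧ FacesConnected F ∧
    (eulerChar F = 2 ∨ (eulerChar F = 1 ∧ (boundaryEdges F).Nonempty))

/-- A triangulation of a disk (= of a polygon, the corners being the boundary
vertices): a connected surface with nonempty boundary and Euler characteristic 1. -/
def IsDisk (F : Finset (Finset V)) : Prop :=
  IsSurfaceWithBoundary F ∧ FacesConnected F ∧ eulerChar F = 1 ∧
    (boundaryEdges F).Nonempty

/-- A proper vertex coloring: the two endpoints of every edge get distinct
colors (for a triangulation: every triangle receives all three colors). -/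
def ProperColoring {C : Type*} (F : Finset (Finset V)) (c : V → C) : Prop :=
  ∀ e ∈ edges F, ∀ u ∈ e, ∀ w ∈ e, u ≠ w → c u ≠ c w

end Fisk

/-- A combinatorial map (rotation `σ` about the tail of a dart, reversal `ρ`) all of whose faces
are triangles, whose vertices have degree 6 except `a` (degree 5) and `b` (degree 7), together
with a closed form `f` on darts bounded by one. -/
structure TightMap (D V : Type*) where
  σ : Equiv.Perm D
  ρ : D → D
  tl : D → V
  f : D → ℝ
  a : V
  b : V
  rev_rev : ∀ x, ρ (ρ x) = x
  triangle : ∀ x, ρ (σ (ρ (σ (ρ (σ x))))) = x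
  tl_rot : ∀ x, tl (σ x) = tl x
  rot_ne : ∀ x, σ x ≠ x
  f_rev : ∀ x, f (ρ x) = - f x
  f_rot : ∀ x, f (σ x) = f x + f (σ.symm (ρ x))
  f_le : ∀ x, f x ≤ 1
  a_ne_b : a ≠ b
  reg : ∀ x, tl x ≠ a → tl x ≠ b → σ (σ (σ (σ (σ (σ x))))) = x
  deg_a : ∀ x, tl x = a → σ (σ (σ (σ (σ x)))) = x
  deg_b : ∀ x, tl x = b → σ (σ (σ (σ (σ (σ (σ x)))))) = x
  transitive : ∀ x y, tl x = tl y → ∃ k : ℕ, σ^[k] x = y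
  connected : ∀ U : Set V, (∀ d, tl d ∈ U → tl (ρ d) ∈ U) → ∀ d e, tl d ∈ U → tl e ∈ U
  exists_b : ∃ d, tl d = b

namespace TightMap

variable {D V : Type*} (M : TightMap D V)

lemma rev_rot_rev (x : D) : M.ρ (M.σ (M.ρ x)) = M.σ.symm (M.ρ (M.σ.symm x)) := by
  have h := M.triangle (M.σ.symm x)
  rw [Equiv.apply_symm_apply] at h
  rw [← h, M.rev_rev, Equiv.symm_apply_apply]

lemma rev_symm_rev (x : D) : M.ρ (M.σ.symm (M.ρ x)) = M.σ (M.ρ (M.σ x)) := by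
  have h := M.rev_rot_rev (M.σ x)
  rw [Equiv.symm_apply_apply] at h
  rw [← h, M.rev_rev]

lemma tl_symm (x : D) : M.tl (M.σ.symm x) = M.tl x := by
  rw [← M.tl_rot (M.σ.symm x), Equiv.apply_symm_apply]

lemma rev_inj {x y : D} (h : M.ρ x = M.ρ y) : x = y := by
  rw [← M.rev_rev x, h, M.rev_rev]

lemma neg_one_le (x : D) : -1 ≤ M.f x := by
  have := M.f_le (M.ρ x)
  rw [M.f_rev] at this
  linarith

lemma f_symm (x : D) : M.f (M.σ.symm x) = M.f x + M.f (M.σ (M.ρ x)) := by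
  have h := M.f_rot (M.σ.symm x)
  rw [Equiv.apply_symm_apply] at h
  have h2 := M.rev_rot_rev x
  have h3 := M.f_rev (M.σ (M.ρ x))
  rw [h2] at h3
  linarith

/-- Consecutive darts around a vertex have values differing by at most one. -/
lemma f_rot_le (x : D) : M.f (M.σ x) ≤ M.f x + 1 := by
  rw [M.f_rot]; linarith [M.f_le (M.σ.symm (M.ρ x))]

lemma le_f_rot (x : D) : M.f x - 1 ≤ M.f (M.σ x) := by
  rw [M.f_rot]; linarith [M.neg_one_le (M.σ.symm (M.ρ x))]

/-- The orientation-reversed map. -/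
def mirror : TightMap D V where
  σ := M.σ.symm
  ρ := M.ρ
  tl := M.tl
  f := M.f
  a := M.a
  b := M.b
  rev_rev := M.rev_rev
  triangle x := by
    rw [M.rev_symm_rev]; simp [M.rev_rev]
  tl_rot := M.tl_symm
  rot_ne x h := M.rot_ne (M.σ.symm x) (by rw [Equiv.apply_symm_apply, h])
  f_rev := M.f_rev
  f_rot x := by simpa using M.f_symm x
  f_le := M.f_le
  a_ne_b := M.a_ne_b
  reg x h1 h2 := by
    conv_lhs => rw [← M.reg x h1 h2]
    simp
  deg_a x h1 := by
    conv_lhs => rw [← M.deg_a x h1]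
    simp
  deg_b x h1 := by
    conv_lhs => rw [← M.deg_b x h1]
    simp
  transitive x y h := by
    obtain ⟨k, hk⟩ := M.transitive y x h.symm
    refine ⟨k, ?_⟩
    rw [← hk]
    exact (Function.LeftInverse.iterate M.σ.symm_apply_apply k) y
  connected := M.connected
  exists_b := M.exists_b

/-- The same map with the form negated. -/
def negate : TightMap D V where
  __ := M
  f := fun x => - M.f x
  f_rev x := by rw [M.f_rev]
  f_rot x := by rw [M.f_rot]; ring
  f_le x := by linarith [M.neg_one_le x]

/-- `M.Walk v w n`: there is a walk of length `n` from `v` to `w` all of whose darts have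
value one. -/
inductive Walk : V → V → ℕ → Prop
  | nil (v : V) : Walk v v 0
  | cons (x : D) {w : V} {n : ℕ} (hx : M.f x = 1) (h : Walk (M.tl (M.ρ x)) w n) :
      Walk (M.tl x) w (n + 1)

variable {M}

lemma Walk.trans {u v w : V} {m n : ℕ} (h : M.Walk u v m) (h' : M.Walk v w n) :
    M.Walk u w (m + n) := by
  induction h with
  | nil v => simpa using h'
  | cons x hx _ ih =>
    rw [Nat.add_right_comm]
    exact .cons x hx (ih h')

lemma Walk.single (x : D) (hx : M.f x = 1) : M.Walk (M.tl x) (M.tl (M.ρ x)) 1 :=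
  .cons x hx (.nil _)

lemma Walk.mirror {u v : V} {m : ℕ} (h : M.Walk u v m) : M.mirror.Walk u v m := by
  induction h with
  | nil v => exact .nil _
  | cons x hx _ ih => exact Walk.cons (M := M.mirror) x hx ih

lemma Walk.of_mirror {u v : V} {m : ℕ} (h : M.mirror.Walk u v m) : M.Walk u v m := h.mirror

lemma Walk.negate {u v : V} {m : ℕ} (h : M.Walk u v m) : M.negate.Walk v u m := by
  induction h with
  | nil v => exact .nil _
  | cons x hx _ ih =>
    have := Walk.single (M := M.negate) (M.ρ x) (by
      change - M.f (M.ρ x) = 1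
      rw [M.f_rev, neg_neg, hx])
    change M.negate.Walk (M.tl (M.ρ x)) (M.tl (M.ρ (M.ρ x))) 1 at this
    rw [M.rev_rev] at this
    exact ih.trans this

lemma Walk.of_negate {u v : V} {m : ℕ} (h : M.negate.Walk u v m) : M.Walk v u m := by
  have h1 := h.negate
  have h2 : M.negate.negate = M := by
    cases M; simp [TightMap.negate]
  rwa [h2] at h1

lemma Walk.exists_nat {u v : V} {m : ℕ} (h : M.Walk u v m) :
    ∃ d : ℕ → D, (∀ i < m, M.f (d i) = 1) ∧ (0 < m → M.tl (d 0) = u) ∧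
      (∀ i, i + 1 < m → M.tl (d (i + 1)) = M.tl (M.ρ (d i))) ∧
      (∀ i, i + 1 = m → M.tl (M.ρ (d i)) = v) ∧ (m = 0 → u = v) := by
  induction h with
  | nil v => 
    obtain ⟨d, hd⟩ := M.exists_b
    exact ⟨fun _ => d, by simp⟩
  | @cons x w n hx _ ih =>
    obtain ⟨d, h1, h2, h3, h4, h5⟩ := ih
    refine ⟨fun i => Nat.casesOn i x d, ?_, by simp, ?_, ?_, by simp⟩
    · rintro (_ | i) hi
      · exact hx
      · exact h1 i (by omega)
    · rintro (_ | i) hi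
      · exact h2 (by omega)
      · exact h3 i (by omega)
    · rintro (_ | i) hi
      · exact h5 (by omega)
      · exact h4 i (by omega)

variable (M)

/-- A closed walk of darts of value one, indexed by `ZMod n`. -/
structure Loop {n : ℕ} (d : ZMod n → D) : Prop where
  tight : ∀ i, M.f (d i) = 1
  chain : ∀ i, M.tl (d (i + 1)) = M.tl (M.ρ (d i))

variable {M}

lemma Walk.exists_loop {v : V} {n : ℕ} [NeZero n] (h : M.Walk v v n) :
    ∃ d : ZMod n → D, M.Loop d ∧ M.tl (d 0) = v := by
  obtain ⟨d, h1, h2, h3, h4, -⟩ := h.exists_nat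
  have hn : 0 < n := Nat.pos_of_ne_zero (NeZero.ne n)
  refine ⟨fun i => d i.val, ⟨fun i => h1 _ i.val_lt, fun i => ?_⟩, by simpa using h2 hn⟩
  have hi := i.val_lt
  rcases Nat.lt_or_ge (i.val + 1) n with h | h
  · have : (i + 1).val = i.val + 1 := by
      rw [ZMod.val_add, ZMod.val_one_eq_one_mod, Nat.add_mod_mod, Nat.mod_eq_of_lt h]
    simp only [this]
    exact h3 _ h
  · have h' : i.val + 1 = n := by omega
    have : (i + 1).val = 0 := by
      rw [ZMod.val_add, ZMod.val_one_eq_one_mod, Nat.add_mod_mod, h', Nat.mod_self]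
    simp only [this]
    rw [h2 hn, h4 _ h']

lemma Loop.walk {n : ℕ} {d : ZMod n → D} (h : M.Loop d) (i : ZMod n) (k : ℕ) :
    M.Walk (M.tl (d i)) (M.tl (d (i + k))) k := by
  induction k with
  | zero => simpa using Walk.nil (M := M) _
  | succ k ih =>
    have := ih.trans (Walk.single _ (h.tight (i + k)))
    rw [← h.chain] at this
    convert this using 2
    push_cast
    ring_nf

lemma Loop.mirror {n : ℕ} {d : ZMod n → D} (h : M.Loop d) : M.mirror.Loop d :=
  ⟨h.tight, h.chain⟩

/-- A shortest closed walk through `b` visits every vertex once. -/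
lemma Loop.injective {n : ℕ} [NeZero n] {d : ZMod n → D} (h : M.Loop d)
    (hmin : ∀ m, 0 < m → M.Walk M.b M.b m → n ≤ m) (hb : ∃ i, M.tl (d i) = M.b)
    {i j : ZMod n} (hij : M.tl (d i) = M.tl (d j)) : i = j := by
  obtain ⟨o, ho⟩ := hb
  by_contra hne
  have key : ∀ p q : ZMod n, M.tl (d p) = M.tl (d q) → p ≠ q →
      (o - p).val < (q - p).val → False := by
    intro p q hpq hne hlt
    have w1 := h.walk p (o - p).val
    have w2 := h.walk o ((q - p).val - (o - p).val)
    have e1 : p + ((o - p).val : ℕ) = o := by rw [ZMod.natCast_zmod_val]; ring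
    have e2 : o + (((q - p).val - (o - p).val : ℕ) : ZMod n) = q := by
      rw [Nat.cast_sub hlt.le, ZMod.natCast_zmod_val, ZMod.natCast_zmod_val]; ring
    rw [e1, ho] at w1
    rw [e2, ho, ← hpq] at w2
    have := hmin _ (by omega) (w2.trans w1)
    have := (q - p).val_lt
    omega
  have hval : ∀ p q : ZMod n, p ≠ q → (q - p).val + (p - q).val = n := by
    intro p q hpq
    have h0 : NeZero (q - p) := ⟨sub_ne_zero.mpr hpq.symm⟩
    have := ZMod.val_neg_of_ne_zero (q - p)
    rw [neg_sub] at this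
    have := (q - p).val_lt
    omega
  rcases Nat.lt_or_ge (o - i).val (j - i).val with hlt | hge
  · exact key i j hij hne hlt
  · refine key j i hij.symm (Ne.symm hne) ?_
    have e : (o - j).val = (o - i).val - (j - i).val := by
      rw [← ZMod.val_sub hge]; congr 1; ring
    have := hval i j hne
    have := (o - i).val_lt
    omega

end TightMap

namespace TightMap

variable {D V : Type*} {M : TightMap D V}

lemma f_sub_iterate_le (k : ℕ) (x : D) : M.f x - M.f (M.σ^[k] x) ≤ k := by
  induction k with
  | zero => simp
  | succ k ih =>
    rw [Function.iterate_succ_apply']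
    push_cast
    linarith [M.le_f_rot (M.σ^[k] x)]

/-- Along a walk of darts of value one, the value of the left neighbour grows by at most the
left angle minus three. -/
lemma turn {i o : D} {l : ℕ} (hi : M.f i = 1) (ho : M.f o = 1) (hl : M.σ^[l] o = M.ρ i) :
    2 ≤ l ∧ M.f (M.σ o) - M.f (M.σ i) ≤ l - 3 := by
  have hr : M.f (M.ρ i) = -1 := by rw [M.f_rev, hi]
  match l, hl with
  | 0, hl => simp only [Function.iterate_zero, id] at hl; rw [hl] at ho; linarith
  | 1, hl =>
    simp only [Function.iterate_one] at hl
    have := M.le_f_rot o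
    rw [hl] at this
    linarith
  | l + 2, hl =>
    refine ⟨by omega, ?_⟩
    have h1 := f_sub_iterate_le (M := M) l (M.σ o)
    rw [← Function.iterate_succ_apply] at h1
    rw [Function.iterate_succ_apply', ← Equiv.eq_symm_apply] at hl
    rw [hl, M.f_symm, M.rev_rev] at h1
    push_cast
    linarith

lemma f_rot_nonneg {i : D} (hi : M.f i = 1) : 0 ≤ M.f (M.σ i) := by
  linarith [M.le_f_rot i]

variable (M) in
/-- The degree of a vertex. -/
noncomputable def deg (v : V) : ℕ := by
  classical exact if v = M.a then 5 else if v = M.b then 7 else 6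

lemma rot_deg (x : D) : M.σ^[M.deg (M.tl x)] x = x := by
  classical
  unfold deg
  split_ifs with h1 h2
  · exact M.deg_a x h1
  · exact M.deg_b x h2
  · exact M.reg x h1 h2

lemma deg_pos (v : V) : 0 < M.deg v := by
  unfold deg; split_ifs <;> norm_num

lemma deg_apply_a : M.deg M.a = 5 := by simp [deg]
lemma deg_apply_b : M.deg M.b = 7 := by simp [deg, M.a_ne_b.symm]
lemma deg_of_ne {v : V} (ha : v ≠ M.a) (hb : v ≠ M.b) : M.deg v = 6 := by simp [deg, ha, hb]

lemma mirror_iterate {k l : ℕ} {x y : D} (h : M.σ^[k] x = y) (hkl : M.σ^[k + l] x = x) :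
    M.mirror.σ^[l] x = y := by
  rw [Nat.add_comm, Function.iterate_add_apply, h] at hkl
  rw [← hkl]
  exact (Function.LeftInverse.iterate M.σ.symm_apply_apply l) y

lemma exists_angles {i o : D} (h : M.tl o = M.tl (M.ρ i)) :
    ∃ l r : ℕ, l + r = M.deg (M.tl o) ∧ M.σ^[l] o = M.ρ i ∧ M.mirror.σ^[r] o = M.ρ i := by
  obtain ⟨k, hk⟩ := M.transitive _ _ h
  have hp : Function.IsPeriodicPt M.σ (M.deg (M.tl o)) o := rot_deg o
  have hl : M.σ^[k % M.deg (M.tl o)] o = M.ρ i := by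
    rw [hp.iterate_mod_apply, hk]
  have hlt := Nat.mod_lt k (deg_pos (M := M) (M.tl o))
  have hs : k % M.deg (M.tl o) + (M.deg (M.tl o) - k % M.deg (M.tl o)) = M.deg (M.tl o) := by
    omega
  refine ⟨_, _, hs, hl, mirror_iterate hl ?_⟩
  rw [hs, rot_deg]

variable (M) in
/-- A closed walk with left angles `l` along which the left neighbours change as much as the
angles allow. -/
def LeftTight {n : ℕ} (d : ZMod n → D) (l : ZMod n → ℕ) : Prop :=
  ∀ i, M.f (M.σ (d (i + 1))) - M.f (M.σ (d i)) = l i - 3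

lemma Loop.sum_left {n : ℕ} [NeZero n] {d : ZMod n → D} (h : M.Loop d) {l : ZMod n → ℕ}
    (hl : ∀ i, M.σ^[l i] (d (i + 1)) = M.ρ (d i)) :
    0 ≤ ∑ i, ((l i : ℤ) - 3) ∧ (∑ i, ((l i : ℤ) - 3) = 0 → M.LeftTight d l) := by
  have h0 : ∀ i ∈ Finset.univ, M.f (M.σ (d (i + 1))) - M.f (M.σ (d i)) ≤ (l i : ℝ) - 3 :=
    fun i _ => (turn (h.tight i) (h.tight (i + 1)) (hl i)).2
  have h1 : ∑ i, (M.f (M.σ (d (i + 1))) - M.f (M.σ (d i))) = 0 := by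
    rw [Finset.sum_sub_distrib, sub_eq_zero]
    exact Equiv.sum_comp (Equiv.addRight (1 : ZMod n)) (fun i => M.f (M.σ (d i)))
  have h2 := Finset.sum_le_sum h0
  rw [h1] at h2
  refine ⟨by exact_mod_cast h2, fun h3 => ?_⟩
  have h4 : ∑ i, ((l i : ℝ) - 3) = 0 := by exact_mod_cast h3
  have h5 := (Finset.sum_eq_sum_iff_of_le h0).1 (by rw [h1, h4])
  exact fun i => h5 i (Finset.mem_univ _)

lemma Loop.exists_angles {n : ℕ} [NeZero n] {d : ZMod n → D} (h : M.Loop d) :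
    ∃ l r : ZMod n → ℕ, (∀ i, l i + r i = M.deg (M.tl (d (i + 1)))) ∧
      (∀ i, M.σ^[l i] (d (i + 1)) = M.ρ (d i)) ∧
      (∀ i, M.mirror.σ^[r i] (d (i + 1)) = M.ρ (d i)) ∧
      0 ≤ ∑ i, ((l i : ℤ) - 3) ∧ 0 ≤ ∑ i, ((r i : ℤ) - 3) ∧
      ∑ i, ((l i : ℤ) - 3) + ∑ i, ((r i : ℤ) - 3) = ∑ i, ((M.deg (M.tl (d i)) : ℤ) - 6) ∧
      (∑ i, ((l i : ℤ) - 3) = 0 → M.LeftTight d l) ∧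
      (∑ i, ((r i : ℤ) - 3) = 0 → M.mirror.LeftTight d r) := by
  choose l r h1 h2 h3 using fun i => TightMap.exists_angles (M := M) (h.chain i)
  obtain ⟨hl, hl'⟩ := h.sum_left h2
  obtain ⟨hr, hr'⟩ := h.mirror.sum_left h3
  refine ⟨l, r, h1, h2, h3, hl, hr, ?_, hl', hr'⟩
  rw [← Finset.sum_add_distrib,
    ← Equiv.sum_comp (Equiv.addRight (1 : ZMod n)) (fun i => ((M.deg (M.tl (d i)) : ℤ) - 6))]
  refine Finset.sum_congr rfl fun i _ => ?_
  have := h1 i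
  simp only [Equiv.coe_addRight]
  omega

lemma Loop.of_not_b {n : ℕ} [NeZero n] {d : ZMod n → D} (h : M.Loop d)
    (hb : ∀ i, M.tl (d i) ≠ M.b) :
    (∀ i, M.tl (d i) ≠ M.a) ∧
    ∃ l r : ZMod n → ℕ, (∀ i, l i + r i = 6) ∧
      (∀ i, M.σ^[l i] (d (i + 1)) = M.ρ (d i)) ∧
      (∀ i, M.mirror.σ^[r i] (d (i + 1)) = M.ρ (d i)) ∧
      M.LeftTight d l ∧ M.mirror.LeftTight d r := by
  obtain ⟨l, r, h1, h2, h3, h4, h5, h6, h7, h8⟩ := h.exists_angles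
  have h9 : ∀ i ∈ Finset.univ, (M.deg (M.tl (d i)) : ℤ) - 6 ≤ 0 := by
    intro i _
    by_cases ha : M.tl (d i) = M.a
    · rw [ha, deg_apply_a]; norm_num
    · rw [deg_of_ne ha (hb i)]; norm_num
  have h10 := Finset.sum_nonpos h9
  have h11 : ∑ i, ((M.deg (M.tl (d i)) : ℤ) - 6) = 0 := by linarith
  have ha : ∀ i, M.tl (d i) ≠ M.a := by
    intro i hi
    have := (Finset.sum_eq_zero_iff_of_nonpos h9).1 h11 i (Finset.mem_univ _)
    rw [hi, deg_apply_a] at this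
    norm_num at this
  refine ⟨ha, l, r, fun i => ?_, h2, h3, h7 (by linarith), h8 (by linarith)⟩
  rw [h1, deg_of_ne (ha _) (hb _)]

lemma Loop.of_b {n : ℕ} [NeZero n] {d : ZMod n → D} (h : M.Loop d)
    (hb : ∀ i j, M.tl (d i) = M.tl (d j) → i = j) (h0 : M.tl (d 0) = M.b) :
    ∃ l r : ZMod n → ℕ, (∀ i, l i + r i = M.deg (M.tl (d (i + 1)))) ∧
      (∀ i, M.σ^[l i] (d (i + 1)) = M.ρ (d i)) ∧
      (∀ i, M.mirror.σ^[r i] (d (i + 1)) = M.ρ (d i)) ∧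
      (M.LeftTight d l ∨ M.mirror.LeftTight d r) ∧
      (∀ i, M.tl (d i) = M.a → M.LeftTight d l ∧ M.mirror.LeftTight d r) := by
  classical
  obtain ⟨l, r, h1, h2, h3, h4, h5, h6, h7, h8⟩ := h.exists_angles
  have hle : ∀ i ∈ Finset.univ, (M.deg (M.tl (d i)) : ℤ) - 6 ≤
      (if i = 0 then 1 else 0) - if M.tl (d i) = M.a then 1 else 0 := by
    intro i _
    by_cases ha : M.tl (d i) = M.a
    · rw [if_pos ha, ha, deg_apply_a]; split_ifs <;> norm_num
    · rw [if_neg ha]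
      by_cases hi : i = 0
      · rw [hi, h0, deg_apply_b]; norm_num
      · rw [deg_of_ne ha fun h => hi (hb _ _ (h.trans h0.symm)), if_neg hi]; norm_num
  have h9 := Finset.sum_le_sum hle
  rw [Finset.sum_sub_distrib (fun i : ZMod n => if i = 0 then (1 : ℤ) else 0),
    Finset.sum_ite_eq'] at h9
  simp only [Finset.mem_univ, if_true] at h9
  have h10 : ∀ i ∈ Finset.univ, (0 : ℤ) ≤ if M.tl (d i) = M.a then 1 else 0 := by
    intro i _; split_ifs <;> norm_num
  refine ⟨l, r, h1, h2, h3, ?_, fun i hi => ?_⟩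
  · have := Finset.sum_nonneg h10
    rcases h4.eq_or_lt with h | h
    · exact .inl (h7 h.symm)
    · exact .inr (h8 (by omega))
  · have := Finset.single_le_sum h10 (Finset.mem_univ i)
    rw [if_pos hi] at this
    exact ⟨h7 (by omega), h8 (by omega)⟩

end TightMap

namespace TightMap

variable {D V : Type*} (M : TightMap D V)

lemma rev_rot_rot_rev (x : D) : M.ρ (M.σ (M.σ (M.ρ x))) =
    M.σ.symm (M.ρ (M.σ.symm (M.σ.symm (M.ρ (M.σ.symm x))))) := by
  rw [← M.rev_rot_rev, ← M.rev_rot_rev, M.rev_rev]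

/-- The side dart of the rung `z` in direction `ε`. -/
def step (z : D) (ε : Bool) : D := bif ε then M.σ.symm z else M.σ.symm (M.σ.symm z)

/-- The rung following the rung `z` in direction `ε`. -/
def next (z : D) (ε : Bool) : D :=
  bif ε then M.σ.symm (M.σ.symm (M.ρ (M.σ.symm z)))
  else M.σ.symm (M.ρ (M.σ.symm (M.σ.symm z)))

/-- The rung straight above the rung `z`. -/
def up (z : D) : D := M.σ (M.σ (M.σ (M.ρ z)))

lemma step_up_true (z : D) : M.step (M.up z) true = M.σ (M.σ (M.ρ z)) := by
  simp [step, up]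

lemma step_up_false (z : D) : M.step (M.up z) false = M.σ (M.ρ z) := by
  simp [step, up]

lemma tl_step (z : D) (ε : Bool) : M.tl (M.step z ε) = M.tl z := by
  cases ε <;> simp [step, tl_symm]

lemma tl_up (z : D) : M.tl (M.up z) = M.tl (M.ρ z) := by
  simp [up, tl_rot]

lemma tl_next (z : D) (ε : Bool) : M.tl (M.next z ε) = M.tl (M.ρ (M.step z ε)) := by
  cases ε <;> simp [step, next, tl_symm]

lemma rev_next (z : D) (ε : Bool) : M.ρ (M.next (M.ρ (M.next z ε)) ε) = z := by
  cases ε <;> simp [next, rev_rev, rev_symm_rev]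

lemma tl_rev_next (z : D) (ε : Bool) :
    M.tl (M.ρ (M.next z ε)) = M.tl (M.ρ (M.step (M.up z) ε)) := by
  cases ε <;> simp [step, next, up, tl_symm, rev_rot_rev, rev_symm_rev, tl_rot, rev_rot_rot_rev]

/-- The form is closed on the parallelogram over a side dart. -/
lemma f_step_up (z : D) (ε : Bool) :
    M.f (M.step z ε) + M.f (M.next z ε) = M.f z + M.f (M.step (M.up z) ε) := by
  cases ε
  · have h1 := M.f_symm z
    have h2 := M.f_symm (M.σ.symm z)
    have h3 := M.f_rot (M.σ (M.ρ (M.σ.symm z)))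
    have h4 := M.f_rot (M.ρ (M.σ.symm z))
    have h5 := M.f_rev (M.σ.symm z)
    have h6 := M.f_rev (M.σ (M.ρ (M.σ.symm z)))
    simp only [step_up_false]
    simp only [step, next, cond_false, rev_rot_rev, rev_rev] at *
    linarith
  · have h1 := M.f_symm z
    have h2 := M.f_rot (M.σ (M.ρ z))
    have h3 := M.f_symm (M.σ.symm (M.ρ (M.σ.symm z)))
    have h4 := M.f_rev (M.σ.symm (M.σ.symm (M.ρ (M.σ.symm z))))
    have h5 := M.f_rev (M.σ (M.ρ z))
    simp only [step_up_true]
    simp only [step, next, cond_true, rev_rot_rev, rev_symm_rev] at *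
    have h6 := M.f_rot (M.ρ (M.σ.symm z))
    have h7 := M.f_rev (M.σ.symm z)
    simp only [rev_rev, Equiv.apply_symm_apply] at *
    linarith

lemma next_up {z : D} {ε : Bool} (h : ∀ x, M.tl x = M.tl (M.ρ (M.next z ε)) →
    M.σ (M.σ (M.σ (M.σ (M.σ (M.σ x))))) = x) :
    M.next (M.up z) ε = M.up (M.next z ε) := by
  have h' : M.σ.symm (M.σ.symm (M.σ.symm (M.ρ (M.next z ε)))) = M.up (M.next z ε) := by
    conv_lhs => rw [← h (M.ρ (M.next z ε)) rfl]
    simp [up]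
  rw [← h']
  cases ε <;> simp [next, up, rev_rot_rev, rev_symm_rev, rev_rot_rot_rev]

/-- Two rung moves in different directions commute around a regular vertex. -/
lemma next_comm {z : D} (h : ∀ x, M.tl x = M.tl (M.ρ (M.σ.symm z)) →
    M.σ (M.σ (M.σ (M.σ (M.σ (M.σ x))))) = x) :
    M.next (M.next z true) false = M.next (M.next z false) true := by
  have h' := h (M.σ.symm (M.σ.symm (M.σ.symm (M.σ.symm (M.ρ (M.σ.symm z)))))) (by
    simp [tl_symm])
  simp only [Equiv.apply_symm_apply] at h'
  simp [next, rev_rot_rot_rev, ← h']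

/-- A closed strip of triangles with rungs `z`, the side darts in directions `ε` having
value one. -/
structure Ladder {n : ℕ} (z : ZMod n → D) (ε : ZMod n → Bool) : Prop where
  tight : ∀ i, M.f (M.step (z i) (ε i)) = 1
  next_eq : ∀ i, M.next (z i) (ε i) = z (i + 1)

variable {M}

lemma Ladder.top {n : ℕ} [NeZero n] {z : ZMod n → D} {ε : ZMod n → Bool} (h : M.Ladder z ε) :
    (∀ i, M.f (z i) = M.f (z 0)) ∧ M.Loop fun i => M.step (M.up (z i)) (ε i) := by
  have h0 : ∀ i, M.f (M.step (M.up (z i)) (ε i)) = 1 + (M.f (z (i + 1)) - M.f (z i)) := by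
    intro i
    have := M.f_step_up (z i) (ε i)
    rw [h.tight, h.next_eq] at this
    linarith
  have h1 : ∑ i, (M.f (z (i + 1)) - M.f (z i)) = 0 := by
    rw [Finset.sum_sub_distrib, sub_eq_zero]
    exact Equiv.sum_comp (Equiv.addRight (1 : ZMod n)) (fun i => M.f (z i))
  have h2 : ∀ i ∈ Finset.univ, M.f (z (i + 1)) - M.f (z i) ≤ 0 := by
    intro i _
    have := M.f_le (M.step (M.up (z i)) (ε i))
    rw [h0] at this
    linarith
  have h3 := (Finset.sum_eq_zero_iff_of_nonpos h2).1 h1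
  refine ⟨fun i => ?_, fun i => ?_, fun i => ?_⟩
  · have key : ∀ k : ℕ, M.f (z k) = M.f (z 0) := by
      intro k
      induction k with
      | zero => simp
      | succ k ih =>
        have := h3 k (Finset.mem_univ _)
        push_cast
        linarith
    rw [← ZMod.natCast_zmod_val i, key]
  · rw [h0, h3 i (Finset.mem_univ _), add_zero]
  · rw [tl_step, tl_up, ← tl_rev_next, h.next_eq]

lemma Ladder.up {n : ℕ} [NeZero n] {z : ZMod n → D} {ε : ZMod n → Bool} (h : M.Ladder z ε)
    (hreg : ∀ i, M.tl (M.ρ (z i)) ≠ M.a ∧ M.tl (M.ρ (z i)) ≠ M.b) :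
    M.Ladder (fun i => M.up (z i)) ε where
  tight := h.top.2.tight
  next_eq i := by
    rw [next_up, h.next_eq]
    intro x hx
    rw [h.next_eq] at hx
    exact M.reg x (hx ▸ (hreg _).1) (hx ▸ (hreg _).2)

/-- The rung starting the strip on the left of the dart `d`. -/
def rung (M : TightMap D V) (d : D) (ε : Bool) : D := bif ε then M.σ d else M.σ (M.σ d)

lemma step_rung (d : D) (ε : Bool) : M.step (M.rung d ε) ε = d := by
  cases ε <;> simp [step, rung]

lemma Loop.ladder {n : ℕ} {d : ZMod n → D} (h : M.Loop d) {l : ZMod n → ℕ} {ε : ZMod n → Bool}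
    (hl : ∀ i, M.σ^[l i] (d (i + 1)) = M.ρ (d i))
    (hε : ∀ i, l i + (ε i).toNat = 3 + (ε (i + 1)).toNat) :
    M.Ladder (fun i => M.rung (d i) (!ε i)) (fun i => !ε i) where
  tight i := by rw [step_rung, h.tight]
  next_eq i := by
    have h1 := hl i
    have h2 := hε i
    cases h3 : ε i <;> cases h4 : ε (i + 1) <;>
      simp only [h3, h4, Bool.toNat_true, Bool.toNat_false] at h2
    · rw [show l i = 3 by omega] at h1
      simp [next, rung, ← h1]
    · rw [show l i = 4 by omega] at h1
      simp [next, rung, ← h1]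
    · rw [show l i = 2 by omega] at h1
      simp [next, rung, ← h1]
    · rw [show l i = 3 by omega] at h1
      simp [next, rung, ← h1]

lemma LeftTight.exists_word {n : ℕ} {d : ZMod n → D} {l : ZMod n → ℕ} (h : M.Loop d)
    (hl : ∀ i, M.σ^[l i] (d (i + 1)) = M.ρ (d i)) (ht : M.LeftTight d l) :
    ∃ ε : ZMod n → Bool, (∀ i, ε i = false ↔ M.f (M.σ (d i)) = 0) ∧
      ∀ i, l i + (ε i).toNat = 3 + (ε (i + 1)).toNat := by
  classical
  refine ⟨fun i => !decide (M.f (M.σ (d i)) = 0), fun i => by simp, fun i => ?_⟩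
  have h1 := ht i
  have p0 := f_rot_nonneg (h.tight i)
  have p1 := M.f_le (M.σ (d i))
  have q0 := f_rot_nonneg (h.tight (i + 1))
  have q1 := M.f_le (M.σ (d (i + 1)))
  have h2 := (turn (h.tight i) (h.tight (i + 1)) (hl i)).1
  have h3 : l i ≤ 4 := by
    have : (l i : ℝ) ≤ 4 := by linarith
    exact_mod_cast this
  by_cases hp : M.f (M.σ (d i)) = 0 <;> by_cases hq : M.f (M.σ (d (i + 1))) = 0 <;>
    simp only [hp, hq, decide_true, decide_false, Bool.not_true, Bool.not_false, Bool.toNat_true,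
      Bool.toNat_false]
  · rw [hp, hq] at h1
    have : (l i : ℝ) = 3 := by linarith
    have : l i = 3 := by exact_mod_cast this
    omega
  · interval_cases hh : l i
    · norm_num at h1; linarith
    · norm_num [hp] at h1; exact absurd h1 hq
    · rfl
  · interval_cases hh : l i
    · rfl
    · norm_num [hq] at h1; exact absurd h1 hp
    · norm_num at h1; linarith
  · have p0 := lt_of_le_of_ne p0 (Ne.symm hp)
    have q0 := lt_of_le_of_ne q0 (Ne.symm hq)
    interval_cases hh : l i
    · norm_num at h1; linarith
    · rfl
    · norm_num at h1; linarith

end TightMap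

namespace TightMap

variable {D V : Type*} {M : TightMap D V}

lemma Loop.rung_loop {n : ℕ} [NeZero n] {d : ZMod n → D} (h : M.Loop d) {l : ZMod n → ℕ}
    (hl : ∀ i, M.σ^[l i] (d (i + 1)) = M.ρ (d i)) (ht : M.LeftTight d l) :
    ∃ ε : ZMod n → Bool, (∀ i, ε i = true ↔ M.f (M.σ (d i)) = 0) ∧
      (∀ i, l i + (!ε i).toNat = 3 + (!ε (i + 1)).toNat) ∧
      M.Ladder (fun i => M.rung (d i) (ε i)) ε := by
  obtain ⟨ε, h1, h2⟩ := ht.exists_word h hl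
  have := h.ladder hl h2
  exact ⟨fun i => !ε i, by simpa using h1, by simpa using h2, this⟩

lemma Loop.closed_walk {n : ℕ} [NeZero n] {d : ZMod n → D} (h : M.Loop d) (i : ZMod n) :
    M.Walk (M.tl (d i)) (M.tl (d i)) n := by
  simpa using h.walk i n

lemma Loop.closed_walk_left {n : ℕ} [NeZero n] {d : ZMod n → D} (h : M.Loop d) {l : ZMod n → ℕ}
    (hl : ∀ i, M.σ^[l i] (d (i + 1)) = M.ρ (d i)) (ht : M.LeftTight d l) (i : ZMod n) (j : ℕ)
    (hj : j ≤ l i) :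
    M.Walk (M.tl (M.ρ (M.σ^[j] (d (i + 1))))) (M.tl (M.ρ (M.σ^[j] (d (i + 1))))) n := by
  obtain ⟨ε, h1, h2, h3⟩ := h.rung_loop hl ht
  have top : ∀ i, M.Walk (M.tl (M.ρ (M.rung (d i) (ε i)))) (M.tl (M.ρ (M.rung (d i) (ε i)))) n := by
    intro i
    have := h3.top.2.closed_walk i
    rwa [tl_step, tl_up] at this
  have left : ∀ i, M.Walk (M.tl (M.ρ (M.σ (d i)))) (M.tl (M.ρ (M.σ (d i)))) n := by
    intro i
    cases hε : ε i
    · have h5 := top (i + 1)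
      have h6 : M.next (M.rung (d i) (ε i)) (ε i) = M.rung (d (i + 1)) (ε (i + 1)) :=
        h3.next_eq i
      rw [← h6, hε] at h5
      simpa [next, rung, rev_symm_rev, tl_rot] using h5
    · have := top i
      rwa [hε] at this
  have hi := (turn (h.tight i) (h.tight (i + 1)) (hl i)).1
  rcases Nat.eq_zero_or_pos j with rfl | hj0
  · have := h.closed_walk (i + 1 + 1)
    rw [h.chain] at this
    exact this
  rcases hj.eq_or_lt with rfl | hjl
  · rw [hl, M.rev_rev]
    exact h.closed_walk i
  rcases Nat.lt_or_ge j 2 with hj2 | hj2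
  · obtain rfl : j = 1 := by omega
    exact left (i + 1)
  by_cases hj3 : j + 1 = l i
  · have h7 := hl i
    rw [← hj3, Function.iterate_succ_apply', ← Equiv.eq_symm_apply] at h7
    rw [h7, rev_symm_rev, tl_rot]
    exact left i
  · have h8 := h2 i
    cases h9 : ε i <;> cases h10 : ε (i + 1) <;>
      simp only [h9, h10, Bool.toNat_true, Bool.toNat_false, Bool.not_true, Bool.not_false] at h8
      <;> try omega
    obtain rfl : j = 2 := by omega
    have := top (i + 1)
    rwa [h10] at this

lemma mirror_iterate_sub {x : D} {j k : ℕ} (hj : j ≤ k) (h : M.σ^[k] x = x) :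
    M.mirror.σ^[k - j] x = M.σ^[j] x :=
  mirror_iterate rfl (by rwa [Nat.add_sub_cancel' hj])

/-- Closed walks of darts of value one spread until they meet `b`. -/
lemma exists_closed_walk_b (h : ∃ v n, 0 < n ∧ M.Walk v v n) : ∃ n, 0 < n ∧ M.Walk M.b M.b n := by
  by_contra hb
  obtain ⟨v, n, hn, hw⟩ := h
  have hne : NeZero n := ⟨hn.ne'⟩
  have hU : ∀ d, M.tl d ∈ {v | ∃ n, 0 < n ∧ M.Walk v v n} →
      M.tl (M.ρ d) ∈ {v | ∃ n, 0 < n ∧ M.Walk v v n} := by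
    rintro x ⟨n, hn, hx⟩
    have hne : NeZero n := ⟨hn.ne'⟩
    refine ⟨n, hn, ?_⟩
    obtain ⟨d, hd, hd0⟩ := hx.exists_loop
    have hdb : ∀ i, M.tl (d i) ≠ M.b := by
      intro i hi
      have := hd.closed_walk i
      rw [hi] at this
      exact hb ⟨n, hn, this⟩
    obtain ⟨ha, l, r, hlr, hl, hr, hlt, hrt⟩ := hd.of_not_b hdb
    have hper : M.σ^[6] (d 0) = d 0 := M.reg _ (ha 0) (hdb 0)
    obtain ⟨j, rfl⟩ := M.transitive _ _ hd0
    rw [← Function.IsPeriodicPt.iterate_mod_apply hper]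
    have hj := Nat.mod_lt j (show 0 < 6 by norm_num)
    generalize j % 6 = j at hj
    have e : d 0 = d (-1 + 1) := by simp
    rcases Nat.lt_or_ge (l (-1)) j with h1 | h1
    · have := hd.mirror.closed_walk_left hr hrt (-1) (6 - j) (by have := hlr (-1); omega)
      rw [← e, mirror_iterate_sub hj.le hper] at this
      exact this.of_mirror
    · have := hd.closed_walk_left hl hlt (-1) j h1
      rwa [← e] at this
  obtain ⟨x, hx⟩ := M.exists_b
  obtain ⟨d, hd, hd0⟩ := hw.exists_loop
  have := M.connected _ hU (d 0) x ⟨n, hn, hd0 ▸ hw⟩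
  rw [hx] at this
  exact hb this

end TightMap

namespace TightMap

variable {D V : Type*} {M : TightMap D V}

lemma next_inj {x y : D} {ε : Bool} (h : M.next x ε = M.next y ε) : x = y := by
  rw [← M.rev_next x ε, h, M.rev_next]

lemma up_injective : Function.Injective M.up := by
  intro x y h
  simp only [up, EmbeddingLike.apply_eq_iff_eq] at h
  exact M.rev_inj h

lemma step_rev_next (z : D) (ε : Bool) :
    M.step (M.ρ (M.next z ε)) ε = M.ρ (M.step (M.up z) ε) := by
  cases ε <;> simp [step, next, up, rev_rot_rev, rev_symm_rev, rev_rot_rot_rev]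

lemma Ladder.reverse {n : ℕ} [NeZero n] {z : ZMod n → D} {ε : ZMod n → Bool} (h : M.Ladder z ε)
    (j : ZMod n) : M.negate.Ladder (fun i => M.ρ (z (j - i))) (fun i => ε (j - i - 1)) where
  tight i := by
    have h1 := h.next_eq (j - i - 1)
    rw [sub_add_cancel] at h1
    have h2 := M.step_rev_next (z (j - i - 1)) (ε (j - i - 1))
    rw [h1] at h2
    change - M.f (M.step (M.ρ (z (j - i))) (ε (j - i - 1))) = 1
    rw [h2, M.f_rev, neg_neg]
    exact h.top.2.tight _
  next_eq i := by
    have h1 := h.next_eq (j - i - 1)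
    rw [sub_add_cancel] at h1
    change M.next (M.ρ (z (j - i))) (ε (j - i - 1)) = M.ρ (z (j - (i + 1)))
    rw [← h1, ← sub_sub, ← M.rev_rev (M.next _ _), rev_next]

/-- Stacking strips on the left of a closed strip through `b`, one meets `b` before any other
singular vertex. -/
lemma Ladder.cylinder [Finite D] {n : ℕ} [NeZero n] {z : ZMod n → D} {ε : ZMod n → Bool}
    (h : M.Ladder z ε) (h0 : M.tl (z 0) = M.b) :
    ∃ (k : ℕ) (j : ZMod n), M.tl (M.ρ (M.up^[k] (z j))) = M.b ∧
      (∀ k' ≤ k, M.Ladder (fun i => M.up^[k'] (z i)) ε) ∧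
      ∀ k' < k, ∀ i, M.tl (M.ρ (M.up^[k'] (z i))) ≠ M.a ∧ M.tl (M.ρ (M.up^[k'] (z i))) ≠ M.b := by
  classical
  have hex : ∃ k, ∃ i, M.tl (M.ρ (M.up^[k] (z i))) = M.a ∨ M.tl (M.ρ (M.up^[k] (z i))) = M.b := by
    obtain ⟨N, hN, hp⟩ := (up_injective (M := M)).mem_periodicPts (z 0)
    obtain ⟨N, rfl⟩ : ∃ m, N = m + 1 := ⟨N - 1, by omega⟩
    refine ⟨N, 0, .inr ?_⟩
    have hp' : M.up^[N + 1] (z 0) = z 0 := hp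
    rw [Function.iterate_succ_apply'] at hp'
    rw [← tl_up, hp', h0]
  have hlt : ∀ k' < Nat.find hex, ∀ i, M.tl (M.ρ (M.up^[k'] (z i))) ≠ M.a ∧
      M.tl (M.ρ (M.up^[k'] (z i))) ≠ M.b := by
    intro k' hk' i
    have := Nat.find_min hex hk'
    push Not at this
    exact this i
  have hlad : ∀ k' ≤ Nat.find hex, M.Ladder (fun i => M.up^[k'] (z i)) ε := by
    intro k'
    induction k' with
    | zero => exact fun _ => h
    | succ k' ih =>
      intro hk
      simp only [Function.iterate_succ_apply']
      exact (ih (by omega)).up (hlt k' (by omega))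
  have : ∃ j, M.tl (M.ρ (M.up^[Nat.find hex] (z j))) = M.b := by
    by_contra hb
    push Not at hb
    obtain ⟨i, hi⟩ := Nat.find_spec hex
    have := ((hlad _ le_rfl).top.2.of_not_b (fun i => by rw [tl_step, tl_up]; exact hb i)).1 i
    rw [tl_step, tl_up] at this
    exact hi.elim this (hb i)
  obtain ⟨j, hj⟩ := this
  exact ⟨_, j, hj, hlad, hlt⟩

variable (M) in
/-- Follow a word of directions. -/
def run (z : D) (w : List Bool) : D := w.foldl M.next z

@[simp] lemma run_nil (z : D) : M.run z [] = z := rfl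
@[simp] lemma run_cons (z : D) (x : Bool) (w : List Bool) :
    M.run z (x :: w) = M.run (M.next z x) w := rfl
lemma run_append (z : D) (p w : List Bool) : M.run z (p ++ w) = M.run (M.run z p) w := by
  simp [run]

lemma run_inj {w : List Bool} {x y : D} (h : M.run x w = M.run y w) : x = y := by
  induction w generalizing x y with
  | nil => exact h
  | cons a w ih => exact next_inj (ih h)

lemma run_reverse (y : D) (w : List Bool) : M.run (M.ρ (M.run y w)) w.reverse = M.ρ y := by
  induction w generalizing y with
  | nil => rfl
  | cons x w ih =>
    rw [run_cons, List.reverse_cons, run_append, ih, run_cons, run_nil,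
      ← M.rev_rev (M.next _ _), rev_next]

variable (M) in
/-- All rungs met along the word have value zero and all side darts value one. -/
def Good : D → List Bool → Prop
  | z, [] => M.f z = 0
  | z, x :: w => M.f z = 0 ∧ M.f (M.step z x) = 1 ∧ Good (M.next z x) w

lemma Good.zero {z : D} {w : List Bool} (h : M.Good z w) : M.f z = 0 := by
  cases w with
  | nil => exact h
  | cons => exact h.1

lemma good_append {z : D} {p w : List Bool} :
    M.Good z (p ++ w) ↔ M.Good z p ∧ M.Good (M.run z p) w := by
  induction p generalizing z with
  | nil => exact ⟨fun h => ⟨h.zero, h⟩, fun h => h.2⟩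
  | cons x p ih => simp [Good, ih, and_assoc]

lemma Good.walk {z : D} {w : List Bool} (h : M.Good z w) :
    M.Walk (M.tl z) (M.tl (M.run z w)) w.length := by
  induction w generalizing z with
  | nil => exact .nil _
  | cons x w ih =>
    have := Walk.cons _ h.2.1 ((tl_next M z x) ▸ ih h.2.2)
    rwa [tl_step] at this

lemma Good.flip_right {z : D} {w : List Bool} (h : M.Good z (true :: false :: w))
    (hb : M.tl (M.next z true) ≠ M.b) :
    M.Good z (false :: true :: w) ∧
      M.run z (false :: true :: w) = M.run z (true :: false :: w) := by
  obtain ⟨h1, h2, h3, h4, h5⟩ := h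
  have htl : M.tl (M.ρ (M.σ.symm z)) = M.tl (M.next z true) := by
    rw [tl_next]; rfl
  have ha : M.tl (M.next z true) ≠ M.a := by
    intro ha
    have h6 := M.deg_a (M.σ.symm (M.σ.symm (M.σ.symm (M.σ.symm (M.ρ (M.σ.symm z)))))) (by
      simpa only [tl_symm, htl] using ha)
    simp only [Equiv.apply_symm_apply] at h6
    simp only [step, next, cond_true, cond_false, ← h6] at h4 h2
    have := M.f_rot_le (M.ρ (M.σ.symm z))
    rw [M.f_rev, h2, h4] at this
    linarith
  have hreg : ∀ x, M.tl x = M.tl (M.ρ (M.σ.symm z)) →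
      M.σ (M.σ (M.σ (M.σ (M.σ (M.σ x))))) = x := fun x hx =>
    M.reg x (by rwa [hx, htl]) (by rwa [hx, htl])
  have hc := M.next_comm hreg
  have h6 := h5.zero
  have e1 : M.step (M.next z true) false = M.σ (M.σ (M.ρ (M.σ.symm z))) := by
    have h' := hreg (M.σ.symm (M.σ.symm (M.σ.symm (M.σ.symm (M.ρ (M.σ.symm z)))))) (by
      simp [tl_symm])
    simp only [Equiv.apply_symm_apply] at h'
    simp only [step, next, cond_true, cond_false, ← h']
  have e2 := M.f_rot (M.σ (M.ρ (M.σ.symm z)))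
  rw [← e1, h4, rev_rot_rev] at e2
  have e3 := M.f_symm (M.σ.symm z)
  have k1 := M.f_le (M.step z false)
  have k2 := M.f_le (M.step (M.next z false) true)
  have k3 := M.f_step_up z false
  have k4 := M.f_step_up (M.next z false) true
  have k5 := M.f_le (M.step (M.up z) false)
  have k6 := M.f_le (M.step (M.up (M.next z false)) true)
  rw [← hc, h6] at k4
  simp only [step, next, cond_true, cond_false] at *
  refine ⟨⟨h1, by simp only [step, cond_false]; linarith, ?_, ?_, ?_⟩, ?_⟩
  · simp only [next, cond_false]; linarith
  · simp only [step, next, cond_true, cond_false]; linarith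
  · simp only [next, cond_true, cond_false]; rwa [← hc]
  · simp only [run_cons, next, cond_true, cond_false, hc]

lemma Good.flip_left {z : D} {w : List Bool} (h : M.Good z (false :: true :: w))
    (hb : ∀ x, M.f x = 1 → M.tl x = M.tl z → M.tl (M.ρ x) ≠ M.b) :
    M.Good z (true :: false :: w) ∧
      M.run z (true :: false :: w) = M.run z (false :: true :: w) := by
  obtain ⟨h1, h2, h3, h4, h5⟩ := h
  have h6 := h5.zero
  have g1 : M.f (M.σ.symm z) = 1 := by
    have e3 := M.f_symm (M.σ.symm z)
    have e4 : M.f (M.next z false) = - M.f (M.σ (M.ρ (M.σ.symm z))) := by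
      rw [← M.f_rev, rev_rot_rev]; rfl
    simp only [step, cond_false] at h2
    linarith
  have e5 : M.σ (M.σ (M.ρ (M.σ.symm z))) = M.σ (M.ρ (M.next z false)) := by
    simp [next, rev_symm_rev]
  have g2 : M.f (M.σ (M.σ (M.ρ (M.σ.symm z)))) = 1 := by
    have e6 := M.f_rot (M.ρ (M.next z false))
    rw [M.f_rev, h3, M.rev_rev] at e6
    simp only [step, cond_true] at h4
    rw [e5]
    linarith
  have hvb := hb _ g1 (M.tl_symm z)
  have ha : M.tl (M.ρ (M.σ.symm z)) ≠ M.a := by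
    intro ha
    have h7 := (turn (l := 3) g1 g2 (M.deg_a _ ha)).2
    have h8 := M.f_rot (M.σ (M.σ (M.ρ (M.σ.symm z))))
    have h9 : M.σ.symm (M.ρ (M.σ (M.σ (M.ρ (M.σ.symm z))))) = M.next (M.next z false) true := by
      rw [e5, rev_rot_rev]; rfl
    rw [h9, h6, g2] at h8
    rw [h8, Equiv.apply_symm_apply, h1] at h7
    norm_num at h7
  have hreg : ∀ x, M.tl x = M.tl (M.ρ (M.σ.symm z)) →
      M.σ (M.σ (M.σ (M.σ (M.σ (M.σ x))))) = x := fun x hx =>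
    M.reg x (by rwa [hx]) (by rwa [hx])
  have hc := M.next_comm hreg
  have e1 : M.step (M.next z true) false = M.σ (M.σ (M.ρ (M.σ.symm z))) := by
    have h' := hreg (M.σ.symm (M.σ.symm (M.σ.symm (M.σ.symm (M.ρ (M.σ.symm z)))))) (by
      simp [tl_symm])
    simp only [Equiv.apply_symm_apply] at h'
    simp only [step, next, cond_true, cond_false, ← h']
  have g3 : M.f (M.step z true) = 1 := g1
  have k3 := M.f_step_up z true
  have k4 := M.f_step_up (M.next z true) false
  have k5 := M.f_le (M.step (M.up z) true)
  have k6 := M.f_le (M.step (M.up (M.next z true)) false)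
  rw [hc, h6, e1, g2] at k4
  refine ⟨⟨h1, g3, by linarith, by rw [e1, g2], by rwa [hc]⟩, ?_⟩
  simp only [run_cons, hc]

/-- Around a shortest closed walk through `b`, the letters of the word may be permuted. -/
lemma Good.perm {n : ℕ} (hmin : ∀ m, 0 < m → M.Walk M.b M.b m → n ≤ m) {z : D}
    (hz : M.tl z = M.b) {w w' : List Bool} (hw : w.Perm w') :
    ∀ p : List Bool, (p ++ w).length = n → M.Good z (p ++ w) →
      M.Good z (p ++ w') ∧ M.run z (p ++ w') = M.run z (p ++ w) := by
  induction hw with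
  | nil => exact fun p _ h => ⟨h, rfl⟩
  | cons x _ ih =>
    intro p hp h
    have := ih (p ++ [x]) (by simpa using hp) (by simpa using h)
    simpa using this
  | trans h1 h2 ih1 ih2 =>
    intro p hp h
    have k1 := ih1 p hp h
    have k2 := ih2 p (by simpa [h1.length_eq] using hp) k1.1
    exact ⟨k2.1, k2.2.trans k1.2⟩
  | swap x y l =>
    intro p hp h
    rw [good_append] at h
    have key : ∀ d, M.f d = 1 → M.tl d = M.tl (M.run z p) → M.tl (M.ρ d) ≠ M.b := by
      intro d hd ht hb
      have h1 := h.1.walk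
      rw [← ht, hz] at h1
      have h2 := h1.trans (Walk.single d hd)
      rw [hb] at h2
      have h3 := hmin _ (by omega) h2
      simp only [List.length_append, List.length_cons] at hp
      omega
    simp only [good_append, run_append]
    refine ⟨⟨h.1, ?_⟩, ?_⟩ <;> cases x <;> cases y
    · exact h.2
    · exact (h.2.flip_right (by rw [tl_next]; exact key _ h.2.2.1 (tl_step ..))).1
    · exact (h.2.flip_left key).1
    · exact h.2
    · rfl
    · exact (h.2.flip_right (by rw [tl_next]; exact key _ h.2.2.1 (tl_step ..))).2
    · exact (h.2.flip_left key).2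
    · rfl

end TightMap

namespace TightMap

variable {D V : Type*} {M : TightMap D V}

/-- The word of a closed strip. -/
noncomputable def word {n : ℕ} (ε : ZMod n → Bool) : List Bool :=
  (List.range n).map fun i : ℕ => ε (i : ZMod n)

lemma Ladder.run_range {n : ℕ} {z : ZMod n → D} {ε : ZMod n → Bool} (h : M.Ladder z ε) (k : ℕ) :
    M.run (z 0) ((List.range k).map fun i : ℕ => ε (i : ZMod n)) = z k := by
  induction k with
  | zero => simp
  | succ k ih =>
    rw [List.range_succ, List.map_append, run_append, ih]
    simp [h.next_eq]

lemma Ladder.run_word {n : ℕ} {z : ZMod n → D} {ε : ZMod n → Bool} (h : M.Ladder z ε) :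
    M.run (z 0) (word ε) = z 0 := by
  rw [word, h.run_range]; simp

lemma Ladder.good_word {n : ℕ} {z : ZMod n → D} {ε : ZMod n → Bool} (h : M.Ladder z ε)
    (h0 : ∀ i, M.f (z i) = 0) : M.Good (z 0) (word ε) := by
  have key : ∀ k : ℕ, M.Good (z 0) ((List.range k).map fun i : ℕ => ε (i : ZMod n)) := by
    intro k
    induction k with
    | zero => exact h0 0
    | succ k ih =>
      rw [List.range_succ, List.map_append, good_append, h.run_range]
      exact ⟨ih, h0 _, h.tight _, by rw [h.next_eq]; exact h0 _⟩
  exact key n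

lemma length_word {n : ℕ} (ε : ZMod n → Bool) : (word ε).length = n := by simp [word]

lemma word_perm {n : ℕ} [NeZero n] (ε : ZMod n → Bool) (e : ZMod n ≃ ZMod n) :
    (word fun i => ε (e i)).Perm (word ε) := by
  have h1 : ((List.range n).map fun i : ℕ => (i : ZMod n)).Nodup := by
    refine List.Nodup.map_on ?_ List.nodup_range
    intro x hx y hy hxy
    rw [List.mem_range] at hx hy
    have := congrArg ZMod.val hxy
    rwa [ZMod.val_natCast_of_lt hx, ZMod.val_natCast_of_lt hy] at this
  have h2 : (((List.range n).map fun i : ℕ => (i : ZMod n)).map e).Perm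
      ((List.range n).map fun i : ℕ => (i : ZMod n)) := by
    rw [List.perm_ext_iff_of_nodup (h1.map e.injective) h1]
    have hmem : ∀ a : ZMod n, a ∈ (List.range n).map fun i : ℕ => (i : ZMod n) := fun a =>
      List.mem_map.2 ⟨a.val, List.mem_range.2 a.val_lt, ZMod.natCast_zmod_val a⟩
    exact fun a => ⟨fun _ => hmem a, fun _ => List.mem_map.2 ⟨e.symm a, hmem _, by simp⟩⟩
  simpa [word, List.map_map, Function.comp_def] using h2.map ε

lemma perm_ends {w : List Bool} (ht : true ∈ w) (hf : false ∈ w) :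
    ∃ m, w.Perm (false :: (m ++ [true])) := by
  have h1 := List.perm_cons_erase hf
  have ht' : true ∈ w.erase false := (List.mem_erase_of_ne (by decide)).2 ht
  have h2 := List.perm_cons_erase ht'
  exact ⟨_, h1.trans ((h2.trans (List.perm_append_singleton _ _).symm).cons _)⟩

/-- Values of the form around `b` next to a rung of a mixed strip. -/
lemma values_around {n : ℕ} (hmin : ∀ m, 0 < m → M.Walk M.b M.b m → n ≤ m) {z : D}
    (hz : M.tl z = M.b) {m : List Bool} (hn : (false :: (m ++ [true])).length = n)
    (hg : M.Good z (false :: (m ++ [true]))) (hr : M.run z (false :: (m ++ [true])) = z) :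
    M.f (M.σ.symm (M.σ.symm z)) = 1 ∧ M.f (M.σ.symm z) = 1 ∧ M.f z = 0 ∧ M.f (M.σ z) = -1 ∧
      M.f (M.σ (M.σ z)) = -1 := by
  have hperm : (false :: (m ++ [true])).Perm (true :: (m ++ [false])) :=
    (((List.perm_append_singleton _ _).cons _).trans (List.Perm.swap _ _ _)).trans
      ((List.perm_append_singleton _ _).symm.cons _)
  have h2 := Good.perm hmin hz hperm [] hn hg
  simp only [List.nil_append] at h2
  obtain ⟨hg', hr'⟩ := h2
  rw [hr] at hr'
  refine ⟨hg.2.1, hg'.2.1, hg.1, ?_, ?_⟩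
  · have h3 := ((good_append (p := true :: m)).1 hg').2
    have h4 : M.next (M.run z (true :: m)) false = z := by
      have := run_append (M := M) z (true :: m) [false]
      exact this.symm.trans hr'
    rw [← h4]
    simp only [next, cond_false, Equiv.apply_symm_apply, M.f_rev]
    rw [neg_inj]
    exact h3.2.1
  · have h3 := ((good_append (p := false :: m)).1 hg).2
    have h4 : M.next (M.run z (false :: m)) true = z := by
      have := run_append (M := M) z (false :: m) [true]
      exact this.symm.trans hr
    rw [← h4]
    simp only [next, cond_true, Equiv.apply_symm_apply, M.f_rev]
    rw [neg_inj]
    exact h3.2.1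

lemma girth_negate {n : ℕ} (hmin : ∀ m, 0 < m → M.Walk M.b M.b m → n ≤ m) :
    ∀ m, 0 < m → M.negate.Walk M.b M.b m → n ≤ m := fun m hm h => hmin m hm h.of_negate

lemma Ladder.f_eq_zero {n : ℕ} [NeZero n] {z : ZMod n → D} {ε : ZMod n → Bool}
    (h : M.Ladder z ε) {i j : ZMod n} (hi : ε i = true) (hj : ε j = false) (l : ZMod n) :
    M.f (z l) = 0 := by
  have hconst := h.top.1
  have k1 := h.tight i
  have k2 := h.tight j
  simp only [step, hi, hj, cond_true, cond_false] at k1 k2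
  have k3 := M.f_rot_le (M.σ.symm (z i))
  have k3' := M.le_f_rot (M.σ.symm (z i))
  have k4 := M.f_symm (M.σ.symm (z j))
  have k5 : M.f (z (j + 1)) = - M.f (M.σ (M.ρ (M.σ.symm (z j)))) := by
    rw [← M.f_rev, rev_rot_rev, ← h.next_eq, hj]; rfl
  have k6 := M.f_le (M.σ.symm (z j))
  rw [Equiv.apply_symm_apply] at k3 k3'
  have c1 := hconst i
  have c2 := hconst (j + 1)
  have c3 := hconst l
  linarith

/-- No shortest closed walk through `b` bounds a strip with side darts in both directions. -/
theorem not_mixed [Finite D] {n : ℕ} [NeZero n] (hmin : ∀ m, 0 < m → M.Walk M.b M.b m → n ≤ m)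
    {z : ZMod n → D} {ε : ZMod n → Bool} (h : M.Ladder z ε) (h0 : M.tl (z 0) = M.b) {i j : ZMod n}
    (hi : ε i = true) (hj : ε j = false) : False := by
  have hzero := h.f_eq_zero hi hj
  obtain ⟨k, p, hp, hlad, -⟩ := h.cylinder h0
  have hlad := hlad k le_rfl
  have htop : ∀ i, M.f (M.up^[k] (z i)) = 0 := hlad.f_eq_zero hi hj
  have hrev := hlad.reverse p
  obtain ⟨m, hm⟩ := perm_ends (w := word ε) (by
    rw [← hi, ← ZMod.natCast_zmod_val i]
    exact List.mem_map.2 ⟨_, List.mem_range.2 i.val_lt, rfl⟩) (by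
    rw [← hj, ← ZMod.natCast_zmod_val j]
    exact List.mem_map.2 ⟨_, List.mem_range.2 j.val_lt, rfl⟩)
  have hlen : (false :: (m ++ [true])).length = n := by rw [← hm.length_eq, length_word]
  have hm' : (word fun i => ε (p - i - 1)).Perm (false :: (m.reverse ++ [true])) := by
    refine ((word_perm ε ((Equiv.subLeft p).trans (Equiv.subRight 1))).trans hm).trans
      (List.Perm.cons _ (List.Perm.append_right _ (List.reverse_perm m).symm))
  have hlen' : (false :: (m.reverse ++ [true])).length = n := by simpa using hlen
  obtain ⟨g1, g2⟩ := Good.perm hmin h0 hm [] (length_word _) (h.good_word hzero)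
  simp only [List.nil_append, h.run_word] at g1 g2
  set y := M.ρ (M.up^[k] (z p)) with hy
  have hy0 : M.ρ (M.up^[k] (z (p - 0))) = y := by rw [sub_zero]
  obtain ⟨g3, g4⟩ := Good.perm (M := M.negate) (girth_negate hmin)
    (z := M.ρ (M.up^[k] (z (p - 0)))) (by rw [hy0]; exact hp) hm' []
    (by rw [List.nil_append]; exact length_word _) (hrev.good_word fun i => by
      change - M.f (M.ρ (M.up^[k] (z (p - i)))) = 0
      rw [M.f_rev, htop]; norm_num)
  simp only [List.nil_append] at g3 g4
  rw [hrev.run_word, hy0] at g4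
  rw [hy0] at g3
  obtain ⟨a1, a2, a3, a4, a5⟩ := values_around hmin h0 hlen g1 g2
  obtain ⟨b1, b2, b3, b4, b5⟩ := values_around (M := M.negate) (girth_negate hmin) hp hlen' g3 g4
  replace b1 : - M.f (M.σ.symm (M.σ.symm y)) = 1 := b1
  replace b2 : - M.f (M.σ.symm y) = 1 := b2
  replace b3 : - M.f y = 0 := b3
  replace b4 : - M.f (M.σ y) = -1 := b4
  replace b5 : - M.f (M.σ (M.σ y)) = -1 := b5
  replace g4 : M.run y (false :: (m.reverse ++ [true])) = y := g4
  generalize z 0 = x at *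
  have h7 := M.deg_b x h0
  obtain ⟨q, hq⟩ := M.transitive x y (h0.trans hp.symm)
  have hper : Function.IsPeriodicPt M.σ 7 x := h7
  rw [← hper.iterate_mod_apply] at hq
  have hq7 := Nat.mod_lt q (show 0 < 7 by norm_num)
  generalize q % 7 = q at hq hq7
  have s1 : M.σ.symm x = M.σ (M.σ (M.σ (M.σ (M.σ (M.σ x))))) := by
    conv_lhs => rw [← h7, Equiv.symm_apply_apply]
  have s2 : M.σ.symm (M.σ.symm x) = M.σ (M.σ (M.σ (M.σ (M.σ x)))) := by
    rw [s1, Equiv.symm_apply_apply]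
  have hrun : M.run (M.ρ y) (true :: (m ++ [false])) = M.ρ y := by
    have := run_reverse (M := M) y (false :: (m.reverse ++ [true]))
    rw [g4] at this
    simpa using this
  rw [run_cons, run_append] at g2 hrun
  have h34 : q = 3 ∨ q = 4 := by
    have : q = 0 ∨ q = 1 ∨ q = 2 ∨ q = 3 ∨ q = 4 ∨ q = 5 ∨ q = 6 := by omega
    rcases this with rfl | rfl | rfl | rfl | rfl | rfl | rfl <;>
      simp only [Function.iterate_succ_apply', Function.iterate_zero, id] at hq <;>
      simp only [← hq, h7, s1, Equiv.symm_apply_apply] at * <;> first | (exfalso; linarith) | simp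
  have e1 : ∀ t, M.next t true = x → M.σ.symm t = M.ρ (M.σ (M.σ x)) := by
    rintro t rfl
    simp [next, rev_rev]
  rcases h34 with rfl | rfl <;>
    simp only [Function.iterate_succ_apply', Function.iterate_zero, id] at hq
  · have e2 : M.run (M.next (M.ρ y) true) m = M.run (M.next x false) m := by
      apply next_inj (M := M) (ε := true)
      have h3 : ∀ t, M.next t false = M.ρ y → M.next t true = x := by
        intro t ht
        have : M.σ.symm (M.σ.symm t) = M.ρ (M.σ (M.ρ y)) := by
          rw [← ht]; simp [next, rev_rev]
        rw [rev_rot_rev, ← hq, Equiv.symm_apply_apply] at this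
        have h4 : M.σ.symm t = M.ρ (M.σ (M.σ x)) := by
          rw [← M.σ.apply_symm_apply (M.σ.symm t), this, Equiv.apply_symm_apply]
        simp [next, h4, rev_rev]
      rw [h3 _ hrun]
      exact g2.symm
    have e3 := run_inj e2
    simp only [next, cond_true, cond_false, s2] at e3
    rw [rev_symm_rev, Equiv.symm_apply_apply, ← hq] at e3
    exact M.rot_ne _ (M.rev_inj (M.σ.symm.injective e3)).symm
  · have e2 : M.next (M.ρ y) true = M.next x false := by
      simp only [next, cond_true, cond_false, s2, rev_symm_rev, ← hq]
      simp
    rw [e2] at hrun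
    have e3 := e1 _ g2
    have e4 : M.next (M.run (M.next x false) m) false = M.ρ y := hrun
    simp only [next, cond_false] at e3 e4
    rw [e3, rev_symm_rev, Equiv.symm_apply_apply, ← hq] at e4
    exact M.rot_ne _ (M.rev_inj e4).symm

end TightMap

namespace TightMap

variable {D V : Type*} {M : TightMap D V}

lemma tl_rung (d : D) (x : Bool) : M.tl (M.rung d x) = M.tl d := by
  cases x <;> simp [rung, tl_rot]

lemma Loop.angles_eq_three [Finite D] {n : ℕ} [NeZero n]
    (hmin : ∀ m, 0 < m → M.Walk M.b M.b m → n ≤ m) {d : ZMod n → D} (h : M.Loop d)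
    (h0 : M.tl (d 0) = M.b) {l : ZMod n → ℕ} (hl : ∀ i, M.σ^[l i] (d (i + 1)) = M.ρ (d i))
    (ht : M.LeftTight d l) (i : ZMod n) : l i = 3 := by
  obtain ⟨ε, -, h2, h3⟩ := h.rung_loop hl ht
  have h0' : M.tl (M.rung (d 0) (ε 0)) = M.b := by rw [tl_rung, h0]
  by_contra hne
  have h2 := h2 i
  cases h4 : ε i <;> cases h5 : ε (i + 1) <;>
    simp only [h4, h5, Bool.toNat_true, Bool.toNat_false, Bool.not_true, Bool.not_false] at h2
  · omega
  · exact not_mixed hmin h3 h0' h5 h4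
  · exact not_mixed hmin h3 h0' h4 h5
  · omega

lemma girth_mirror {n : ℕ} (hmin : ∀ m, 0 < m → M.Walk M.b M.b m → n ≤ m) :
    ∀ m, 0 < m → M.mirror.Walk M.b M.b m → n ≤ m := fun m hm h => hmin m hm h.of_mirror

/-- A shortest closed walk through `b` meets no other singular vertex. -/
lemma Loop.regular [Finite D] {n : ℕ} [NeZero n]
    (hmin : ∀ m, 0 < m → M.Walk M.b M.b m → n ≤ m) {d : ZMod n → D} (h : M.Loop d)
    (h0 : M.tl (d 0) = M.b) {i : ZMod n} (hi : i ≠ 0) : M.tl (d i) ≠ M.a ∧ M.tl (d i) ≠ M.b := by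
  have hinj : ∀ i j, M.tl (d i) = M.tl (d j) → i = j := fun i j => h.injective hmin ⟨0, h0⟩
  refine ⟨fun ha => ?_, fun hb => hi (hinj _ _ (hb.trans h0.symm))⟩
  obtain ⟨l, r, h1, h2, h3, -, h5⟩ := h.of_b hinj h0
  obtain ⟨h6, h7⟩ := h5 i ha
  have k1 := h.angles_eq_three hmin h0 h2 h6 (i - 1)
  have k2 := h.mirror.angles_eq_three (girth_mirror hmin) h0 h3 h7 (i - 1)
  have k3 := h1 (i - 1)
  rw [k1, k2, sub_add_cancel, ha, deg_apply_a] at k3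
  omega

lemma step_up_next (z : D) (ε : Bool) :
    M.step (M.up (M.next z ε)) ε = M.up (M.step (M.up z) ε) := by
  cases ε <;> simp [step, next, up, rev_rot_rev, rev_symm_rev, rev_rot_rot_rev]

/-- Above a closed walk with all left angles three, a strip in constant direction leads to another
closed walk through `b` with all right angles three. -/
lemma Loop.exists_straight_top [Finite D] {n : ℕ} [NeZero n] {d : ZMod n → D} (h : M.Loop d)
    (h0 : M.tl (d 0) = M.b) (h3 : ∀ i, M.σ^[3] (d (i + 1)) = M.ρ (d i)) (x : Bool) :
    ∃ (k : ℕ) (j : ZMod n) (e : ZMod n → D), M.Loop e ∧ M.tl (e 0) = M.b ∧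
      (∀ i, e (i + 1) = M.up (e i)) ∧
      (∀ i, e (i - j) = M.step (M.up (M.up^[k] (M.rung (d i) x))) x) ∧
      ∀ k' < k, ∀ i, M.tl (M.ρ (M.up^[k'] (M.rung (d i) x))) ≠ M.a ∧
        M.tl (M.ρ (M.up^[k'] (M.rung (d i) x))) ≠ M.b := by
  have hz := h.ladder (l := fun _ => 3) (ε := fun _ => !x) h3 (fun _ => rfl)
  simp only [Bool.not_not] at hz
  obtain ⟨k, j, hj, hlad, hreg⟩ := hz.cylinder (by rw [tl_rung, h0])
  have hlad := hlad k le_rfl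
  refine ⟨k, j, fun i => M.step (M.up (M.up^[k] (M.rung (d (i + j)) x))) x, ⟨fun i => ?_, fun i => ?_⟩,
    ?_, fun i => ?_, fun i => ?_, hreg⟩
  · exact hlad.top.2.tight (i + j)
  · have := hlad.top.2.chain (i + j)
    rwa [add_right_comm] at this
  · simp only [zero_add, tl_step, tl_up, hj]
  · have := hlad.next_eq (i + j)
    simp only [add_right_comm i 1 j, ← step_up_next] at this ⊢
    rw [this]
  · simp only [sub_add_cancel]

lemma induction_zmod {n : ℕ} [NeZero n] {P : ZMod n → Prop} (h0 : P 0)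
    (h : ∀ i, P i → i + 1 ≠ 0 → P (i + 1)) (i : ZMod n) : P i := by
  have key : ∀ k : ℕ, k < n → P (k : ZMod n) := by
    intro k
    induction k with
    | zero => intro _; simpa using h0
    | succ k ih =>
      intro hk
      rw [Nat.cast_succ]
      refine h _ (ih (by omega)) fun h1 => ?_
      rw [← Nat.cast_succ, ZMod.natCast_eq_zero_iff] at h1
      exact absurd (Nat.le_of_dvd (by omega) h1) (by omega)
  rw [← ZMod.natCast_zmod_val i]
  exact key _ i.val_lt

lemma straight_angle {n : ℕ} [NeZero n] {d e : ZMod n → D} (hd : M.Loop d) (he : M.Loop e)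
    (hd0 : M.tl (d 0) = M.b) (he0 : M.tl (e 0) = M.b)
    (hdr : ∀ i, i ≠ 0 → M.tl (d i) ≠ M.a ∧ M.tl (d i) ≠ M.b)
    (h3 : ∀ i, M.σ^[3] (d (i + 1)) = M.ρ (d i)) (hu : ∀ i, e (i + 1) = M.up (e i)) :
    e 0 = M.σ (d 0) ∨ e 0 = M.σ (M.σ (M.σ (M.σ (M.σ (d 0))))) := by
  have h7 := M.deg_b _ hd0
  have hreg : ∀ i, i ≠ 0 → ∀ x, M.tl x = M.tl (d i) →
      M.σ (M.σ (M.σ (M.σ (M.σ (M.σ x))))) = x := fun i hi x hx =>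
    M.reg x (by rw [hx]; exact (hdr i hi).1) (by rw [hx]; exact (hdr i hi).2)
  have hd1 : M.f (M.σ (M.σ (M.σ (d 0)))) = -1 := by
    have := h3 (-1)
    rw [neg_add_cancel] at this
    have e1 : M.σ (M.σ (M.σ (d 0))) = M.ρ (d (-1)) := this
    rw [e1, M.f_rev, hd.tight]
  have hu0 : e 0 = M.σ (M.σ (M.σ (M.ρ (e (-1))))) := by
    have := hu (-1)
    rwa [neg_add_cancel] at this
  obtain ⟨q, hq⟩ := M.transitive (d 0) (e 0) (hd0.trans he0.symm)
  have hper : Function.IsPeriodicPt M.σ 7 (d 0) := h7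
  rw [← hper.iterate_mod_apply] at hq
  have hq7 := Nat.mod_lt q (show 0 < 7 by norm_num)
  generalize q % 7 = q at hq hq7
  have g0 := hd.tight 0
  have g1 := M.f_le (M.σ (M.σ (d 0)))
  have l2 := M.f_rot_le (M.σ (M.σ (d 0)))
  have l3 := M.f_rot_le (M.σ (M.σ (M.σ (d 0))))
  have m2 := M.le_f_rot (M.σ (M.σ (d 0)))
  have he1 := he.tight 0
  have : q = 0 ∨ q = 1 ∨ q = 2 ∨ q = 3 ∨ q = 4 ∨ q = 5 ∨ q = 6 := by omega
  rcases this with rfl | rfl | rfl | rfl | rfl | rfl | rfl <;>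
    simp only [Function.iterate_succ_apply', Function.iterate_zero, id] at hq
  · exfalso
    have key : ∀ i, d i = e i := by
      refine induction_zmod hq fun i hi hi0 => ?_
      rw [hu, ← hi, up, ← h3]
      exact (hreg _ hi0 _ rfl).symm
    have h8 := h3 (-1)
    rw [neg_add_cancel, key (-1)] at h8
    rw [← h8, ← hq] at hu0
    simp only [Function.iterate_succ_apply', Function.iterate_zero, id] at hu0
    rw [← hu0] at h7
    exact M.rot_ne _ h7
  · exact .inl hq.symm
  · rw [← hq] at he1; linarith
  · rw [← hq] at he1; linarith
  · rw [← hq] at he1; linarith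
  · exact .inr hq.symm
  · exfalso
    have key : ∀ i, d (-1 - i) = e (-1 - i) := by
      refine induction_zmod ?_ fun i hi hi0 => ?_
      · rw [sub_zero]
        apply M.rev_inj
        rw [← hq] at hu0
        simp only [EmbeddingLike.apply_eq_iff_eq] at hu0
        rw [← hu0, ← h3, neg_add_cancel]
        rfl
      · apply M.rev_inj
        have e1 : (-1 : ZMod n) - (i + 1) + 1 = -1 - i := by ring
        have h8 := h3 (-1 - (i + 1))
        have h9 := hu (-1 - (i + 1))
        rw [e1] at h8 h9
        rw [← h8, hi, h9, up]
        simp only [Function.iterate_succ_apply', Function.iterate_zero, id]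
        refine hreg (-1 - i) ?_ _ ?_
        · intro h; apply hi0; linear_combination -h
        · rw [← tl_up, ← h9, hi]
    have := key (-1)
    rw [sub_self] at this
    rw [this] at hq
    have h10 := congrArg M.σ hq
    rw [← this, h7] at h10
    exact M.rot_ne _ h10.symm

/-- There is no closed walk of darts of value one. -/
theorem not_walk [Finite D] (h : ∃ v n, 0 < n ∧ M.Walk v v n) : False := by
  classical
  have hex := exists_closed_walk_b h
  obtain ⟨hn, hw⟩ := Nat.find_spec hex
  have hmin : ∀ m, 0 < m → M.Walk M.b M.b m → Nat.find hex ≤ m :=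
    fun m hm hm' => Nat.find_min' hex ⟨hm, hm'⟩
  generalize Nat.find hex = n at hn hw hmin
  have : NeZero n := ⟨hn.ne'⟩
  obtain ⟨d, hd, hd0⟩ := hw.exists_loop
  obtain ⟨l, r, -, hl, hr, hlr, -⟩ := hd.of_b (fun i j => hd.injective hmin ⟨0, hd0⟩) hd0
  clear h hex hw
  wlog hlt : M.LeftTight d l generalizing M l r
  · exact this (M := M.mirror) (girth_mirror hmin) hd.mirror hd0 hr
      (l := r) (r := l) hl hlr.symm (hlr.resolve_left hlt)
  have h3 : ∀ i, M.σ^[3] (d (i + 1)) = M.ρ (d i) := by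
    intro i
    have := hl i
    rwa [hd.angles_eq_three hmin hd0 hl hlt i] at this
  have hdr : ∀ i, i ≠ 0 → M.tl (d i) ≠ M.a ∧ M.tl (d i) ≠ M.b := fun i => hd.regular hmin hd0
  obtain ⟨k, j, e, he, he0, hu, hes, -⟩ := hd.exists_straight_top hd0 h3 true
  obtain ⟨k', j', e', he', he0', hu', hes', hreg'⟩ := hd.exists_straight_top hd0 h3 false
  rcases straight_angle hd he hd0 he0 hdr h3 hu with h1 | h5
  · have key : ∀ m : ℕ, e m = M.up^[m] (M.σ (d 0)) := by
      intro m
      induction m with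
      | zero => simpa using h1
      | succ m ih => rw [Nat.cast_succ, hu, ih, Function.iterate_succ_apply']
    have k1 := hes 0
    have k2 := key (k + 1)
    have k3 : ((k + 1 : ℕ) : ZMod n) = 0 - j := by
      apply he.injective hmin ⟨0, he0⟩
      rw [k1, k2, tl_step, Function.iterate_succ_apply']
      rfl
    rw [k3, k1, Function.iterate_succ_apply', step_up_true] at k2
    exact M.rot_ne _ k2.symm
  rcases straight_angle hd he' hd0 he0' hdr h3 hu' with h1' | h5'
  · have f1 := he.tight 0
    have f2 := he'.tight (-1)
    have k1 := hu' (-1)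
    have h7 := M.deg_b _ hd0
    rw [neg_add_cancel, h1', up, ← h7] at k1
    simp only [EmbeddingLike.apply_eq_iff_eq] at k1
    rw [h5, k1, M.f_rev, f2] at f1
    norm_num at f1
  · have key : ∀ m : ℕ, m ≤ k' → M.ρ (e' (-1 - m)) = M.up^[m] (M.σ (M.σ (d 0))) := by
      intro m
      induction m with
      | zero =>
        intro _
        have k1 := hu' (-1)
        rw [neg_add_cancel, h5', up] at k1
        simp only [EmbeddingLike.apply_eq_iff_eq] at k1
        simp [k1]
      | succ m ih =>
        intro hm
        have k1 := hreg' m (by omega) 0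
        have k2 := ih (by omega)
        have k3 := hu' (-1 - (m + 1 : ℕ))
        have e1 : (-1 : ZMod n) - (m + 1 : ℕ) + 1 = -1 - m := by push_cast; ring
        rw [e1] at k3
        have k4 : M.rung (d 0) false = M.σ (M.σ (d 0)) := rfl
        rw [k4, ← k2, M.rev_rev] at k1
        have k5 := M.reg (M.ρ (e' (-1 - (m + 1 : ℕ))))
          (by rw [← tl_up, ← k3]; exact k1.1) (by rw [← tl_up, ← k3]; exact k1.2)
        rw [Function.iterate_succ_apply', ← k2, up, M.rev_rev, k3, up, k5]
    have k1 := hes' 0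
    have k2 := key k' le_rfl
    have k2' : e' (-1 - k') = M.ρ (M.up^[k'] (M.σ (M.σ (d 0)))) := by rw [← k2, M.rev_rev]
    have k3 : (-1 - k' : ZMod n) = 0 - j' := by
      apply he'.injective hmin ⟨0, he0'⟩
      rw [k1, k2', tl_step, tl_up]
      rfl
    rw [k3, k1, step_up_false] at k2'
    exact M.rot_ne _ k2'

end TightMap

/-- The coboundary of a function on the vertices. -/
def coboundary {D W : Type*} (ρ : D → D) (tl : D → W) : (W → ℝ) →ₗ[ℝ] (D → ℝ) where
  toFun g d := g (tl (ρ d)) - g (tl d)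
  map_add' g h := by ext d; simp; ring
  map_smul' c g := by ext d; simp; ring

/-- A class of functions containing a non-coboundary contains a function of norm one that no
coboundary brings closer to zero. -/
lemma exists_minimal_form {D W : Type*} [Fintype D] [Fintype W] [Nonempty W] (ρ : D → D)
    (tl : D → W) (K : Submodule ℝ (D → ℝ)) (hK : Fintype.card W ≤ Module.finrank ℝ K)
    (hδ : ∀ g, coboundary ρ tl g ∈ K) :
    ∃ f ∈ K, ‖f‖ = 1 ∧ ∀ g, 1 ≤ ‖f - coboundary ρ tl g‖ := by
  have hlt : Module.finrank ℝ (LinearMap.range (coboundary ρ tl)) < Module.finrank ℝ K := by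
    have h1 := LinearMap.finrank_range_add_finrank_ker (coboundary ρ tl)
    have h2 : 0 < Module.finrank ℝ (LinearMap.ker (coboundary ρ tl)) := by
      rw [Module.finrank_pos_iff_exists_ne_zero]
      refine ⟨⟨fun _ => 1, ?_⟩, ?_⟩
      · ext d; simp [coboundary]
      · intro h
        have := congrFun (congrArg Subtype.val h) (Classical.arbitrary W)
        simp at this
    rw [Module.finrank_fintype_fun_eq_card] at h1
    omega
  have hex : ∃ c ∈ K, c ∉ LinearMap.range (coboundary ρ tl) := by
    by_contra h
    push Not at h
    exact absurd (Submodule.finrank_mono (show K ≤ _ from h)) (by omega)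
  obtain ⟨c, hcK, hc⟩ := hex
  have hcl : IsClosed (LinearMap.range (coboundary ρ tl) : Set (D → ℝ)) :=
    Submodule.closed_of_finiteDimensional _
  obtain ⟨y, hy, hyd⟩ := hcl.exists_infDist_eq_dist ⟨0, Submodule.zero_mem _⟩ c
  have hmin : ∀ g, ‖c - y‖ ≤ ‖c - coboundary ρ tl g‖ := by
    intro g
    rw [← dist_eq_norm, ← dist_eq_norm, ← hyd]
    exact Metric.infDist_le_dist_of_mem ⟨g, rfl⟩
  have hne : c - y ≠ 0 := by
    intro h
    rw [sub_eq_zero] at h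
    exact hc (h ▸ hy)
  have hpos := norm_pos_iff.2 hne
  obtain ⟨y, rfl⟩ := hy
  refine ⟨‖c - coboundary ρ tl y‖⁻¹ • (c - coboundary ρ tl y),
    K.smul_mem _ (K.sub_mem hcK (hδ y)), ?_, fun g => ?_⟩
  · rw [norm_smul, norm_inv, norm_norm, inv_mul_cancel₀ hpos.ne']
  · set r := ‖c - coboundary ρ tl y‖
    have h1 : r⁻¹ • (c - coboundary ρ tl y) - coboundary ρ tl g =
        r⁻¹ • (c - coboundary ρ tl (y + r • g)) := by
      rw [map_add, map_smul, ← sub_sub, smul_sub r⁻¹ _ (r • _), smul_smul,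
        inv_mul_cancel₀ hpos.ne', one_smul]
    rw [h1, norm_smul, norm_inv, Real.norm_of_nonneg hpos.le, ← inv_mul_cancel₀ hpos.ne']
    exact mul_le_mul_of_nonneg_left (hmin _) (inv_nonneg.2 hpos.le)

/-- An antisymmetric function of norm one that no coboundary brings closer to zero attains the
value one all along some closed walk. -/
lemma exists_cycle_of_minimal {D W : Type*} [Fintype D] [Fintype W] (ρ : D → D) (tl : D → W)
    (f : D → ℝ) (hρ : ∀ d, ρ (ρ d) = d) (hf : ∀ d, f (ρ d) = - f d) (h1 : ‖f‖ = 1)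
    (hmin : ∀ g, 1 ≤ ‖f - coboundary ρ tl g‖) :
    ∃ v, Relation.TransGen (fun v w => ∃ d, tl d = v ∧ tl (ρ d) = w ∧ f d = 1) v v := by
  classical
  by_contra hno
  push Not at hno
  set R := fun v w => ∃ d, tl d = v ∧ tl (ρ d) = w ∧ f d = 1
  let h : W → ℝ := fun v => ((Finset.univ.filter fun u => Relation.TransGen R u v).card : ℝ)
  have hstep : ∀ d, f d = 1 → 1 ≤ coboundary ρ tl h d := by
    intro d hd
    have hR : R (tl d) (tl (ρ d)) := ⟨d, rfl, rfl, hd⟩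
    have : (Finset.univ.filter fun u => Relation.TransGen R u (tl d)).card <
        (Finset.univ.filter fun u => Relation.TransGen R u (tl (ρ d))).card := by
      refine Finset.card_lt_card ⟨fun u hu => ?_, fun hs => ?_⟩
      · simp only [Finset.mem_filter, Finset.mem_univ, true_and] at hu ⊢
        exact hu.tail hR
      · have : tl d ∈ Finset.univ.filter fun u => Relation.TransGen R u (tl d) :=
          hs (by simpa using Relation.TransGen.single hR)
        simp only [Finset.mem_filter, Finset.mem_univ, true_and] at this
        exact hno _ this
    have h2 : ((Finset.univ.filter fun u => Relation.TransGen R u (tl d)).card : ℝ) + 1 ≤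
        (Finset.univ.filter fun u => Relation.TransGen R u (tl (ρ d))).card := by
      exact_mod_cast this
    change 1 ≤ h (tl (ρ d)) - h (tl d)
    simp only [h]
    linarith
  have hanti : ∀ d, coboundary ρ tl h (ρ d) = - coboundary ρ tl h d := by
    intro d
    simp [coboundary, hρ]
  have hev : ∀ᶠ t : ℝ in nhdsWithin 0 (Set.Ioi 0), ∀ d, f d - t * coboundary ρ tl h d < 1 := by
    rw [Filter.eventually_all]
    intro d
    have hle : f d ≤ 1 := by
      have := norm_le_pi_norm f d
      rw [h1] at this
      exact (le_abs_self _).trans this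
    rcases hle.eq_or_lt with heq | hlt
    · filter_upwards [self_mem_nhdsWithin] with t ht
      have ht : 0 < t := ht
      nlinarith [hstep d heq]
    · have hc : Filter.Tendsto (fun t : ℝ => f d - t * coboundary ρ tl h d) (nhds 0)
          (nhds (f d - 0 * coboundary ρ tl h d)) :=
        Continuous.tendsto (by fun_prop) 0
      rw [zero_mul, sub_zero] at hc
      exact (hc.mono_left nhdsWithin_le_nhds).eventually_lt_const hlt
  obtain ⟨t, ht⟩ := hev.exists
  have hlt : ‖f - coboundary ρ tl (t • h)‖ < 1 := by
    rw [pi_norm_lt_iff one_pos]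
    intro d
    rw [map_smul]
    have h2 := ht d
    have h3 := ht (ρ d)
    rw [hf, hanti] at h3
    simp only [Pi.sub_apply, Pi.smul_apply, smul_eq_mul, Real.norm_eq_abs, abs_lt]
    constructor <;> linarith
  exact absurd (hmin (t • h)) (by linarith)

/-- On a closed triangulated surface of nonpositive Euler characteristic there is a closed form
bounded by one attaining the value one all along some closed walk. -/
lemma exists_tight_form {D W E F : Type*} [Fintype D] [Fintype W] [Fintype E] [Fintype F]
    [Nonempty W] (ρ φ : D → D) (tl : D → W) (s : E → D) (t : F → D) (hρ : ∀ d, ρ (ρ d) = d)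
    (hφ : ∀ d, φ (φ (φ d)) = d) (htl : ∀ d, tl (φ d) = tl (ρ d))
    (hs : ∀ d, ∃ e, d = s e ∨ d = ρ (s e))
    (ht : ∀ d, ∃ k, d = t k ∨ d = φ (t k) ∨ d = φ (φ (t k)))
    (hcard : Fintype.card W + (Fintype.card E + Fintype.card F) ≤ Fintype.card D) :
    ∃ f : D → ℝ, (∀ d, f (ρ d) = - f d) ∧ (∀ d, f d + f (φ d) + f (φ (φ d)) = 0) ∧
      (∀ d, f d ≤ 1) ∧
      ∃ v, Relation.TransGen (fun v w => ∃ d, tl d = v ∧ tl (ρ d) = w ∧ f d = 1) v v := by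
  let Φ : (D → ℝ) →ₗ[ℝ] (E → ℝ) × (F → ℝ) :=
    { toFun := fun c => (fun e => c (s e) + c (ρ (s e)),
        fun k => c (t k) + c (φ (t k)) + c (φ (φ (t k))))
      map_add' := fun c c' => by ext <;> simp <;> ring
      map_smul' := fun r c => by ext <;> simp <;> ring }
  have hmem : ∀ c, c ∈ LinearMap.ker Φ ↔ (∀ d, c (ρ d) = - c d) ∧
      ∀ d, c d + c (φ d) + c (φ (φ d)) = 0 := by
    intro c
    rw [LinearMap.mem_ker]
    constructor
    · intro h
      have h1 : ∀ e, c (s e) + c (ρ (s e)) = 0 := congrFun (congrArg Prod.fst h)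
      have h2 : ∀ k, c (t k) + c (φ (t k)) + c (φ (φ (t k))) = 0 := congrFun (congrArg Prod.snd h)
      refine ⟨fun d => ?_, fun d => ?_⟩
      · obtain ⟨e, rfl | rfl⟩ := hs d
        · linarith [h1 e]
        · rw [hρ]; linarith [h1 e]
      · obtain ⟨k, rfl | rfl | rfl⟩ := ht d
        · exact h2 k
        · rw [hφ]; linarith [h2 k]
        · rw [hφ]; linarith [h2 k]
    · rintro ⟨h1, h2⟩
      refine Prod.ext (funext fun e => ?_) (funext fun k => h2 _)
      change c (s e) + c (ρ (s e)) = 0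
      rw [h1]; ring
  have hK : Fintype.card W ≤ Module.finrank ℝ (LinearMap.ker Φ) := by
    have h1 := LinearMap.finrank_range_add_finrank_ker Φ
    have h2 := Submodule.finrank_le (LinearMap.range Φ)
    rw [Module.finrank_prod, Module.finrank_fintype_fun_eq_card,
      Module.finrank_fintype_fun_eq_card] at h2
    rw [Module.finrank_fintype_fun_eq_card] at h1
    omega
  obtain ⟨f, hf, hf1, hfmin⟩ := exists_minimal_form ρ tl (LinearMap.ker Φ) hK fun g => by
    rw [hmem]
    refine ⟨fun d => ?_, fun d => ?_⟩
    · simp [coboundary, hρ]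
    · simp only [coboundary, LinearMap.coe_mk, AddHom.coe_mk, ← htl, hφ]
      ring
  rw [hmem] at hf
  refine ⟨f, hf.1, hf.2, fun d => ?_, exists_cycle_of_minimal ρ tl f hρ hf.1 hf1 hfmin⟩
  have := norm_le_pi_norm f d
  rw [hf1] at this
  exact (le_abs_self _).trans this

namespace Fisk

variable {V : Type*} [DecidableEq V] {F : Finset (Finset V)} {o : Finset V → V × V × V}

variable (F o) in
/-- `x, y, w` is a face in the chosen cyclic order. -/
def Tri (x y w : V) : Prop :=
  ∃ f ∈ F, o f = (x, y, w) ∨ o f = (y, w, x) ∨ o f = (w, x, y)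

variable (F o) in
/-- `o` is a coherent orientation of the closed surface `F`. -/
structure Oriented : Prop where
  card_face : ∀ f ∈ F, f.card = 3
  card_star : ∀ e ∈ edges F, (F.filter (fun f => e ⊆ f)).card = 2
  face_eq : ∀ f ∈ F, ({(o f).1, (o f).2.1, (o f).2.2} : Finset V) = f
  disj : ∀ f ∈ F, ∀ g ∈ F, f ≠ g → ∀ p ∈ orientedEdges (o f), p ∉ orientedEdges (o g)

omit [DecidableEq V] in
lemma Tri.rot {x y w : V} (h : Tri F o x y w) : Tri F o y w x := by
  obtain ⟨f, hf, h⟩ := h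
  exact ⟨f, hf, by tauto⟩

lemma pair_mem_edges {x y : V} {f : Finset V} (hf : f ∈ F) (hx : x ∈ f) (hy : y ∈ f)
    (hxy : x ≠ y) : ({x, y} : Finset V) ∈ edges F := by
  rw [edges, Finset.mem_biUnion]
  refine ⟨f, hf, ?_⟩
  rw [Finset.mem_powersetCard]
  exact ⟨by simp [Finset.insert_subset_iff, hx, hy], Finset.card_pair hxy⟩

namespace Oriented

variable (H : Oriented F o)
include H

lemma tri_face {x y w : V} (h : Tri F o x y w) : ({x, y, w} : Finset V) ∈ F := by
  obtain ⟨f, hf, h⟩ := h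
  have h1 := H.face_eq f hf
  have : ({x, y, w} : Finset V) = f := by
    rw [← h1]
    rcases h with h | h | h <;> rw [h] <;> ext z <;> simp <;> tauto
  rwa [this]

lemma tri_ne {x y w : V} (h : Tri F o x y w) : x ≠ y ∧ y ≠ w ∧ x ≠ w := by
  have := H.card_face _ (H.tri_face h)
  rw [Finset.card_eq_three] at this
  have h2 : ({x, y, w} : Finset V).card = 3 := H.card_face _ (H.tri_face h)
  refine ⟨?_, ?_, ?_⟩ <;> rintro rfl
  · have := Finset.card_le_two (a := x) (b := w)
    simp only [Finset.mem_insert, true_or, Finset.insert_eq_of_mem] at h2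
    omega
  · have := Finset.card_le_two (a := x) (b := y)
    simp at h2
    omega
  · have := Finset.card_le_two (a := x) (b := y)
    rw [Finset.pair_comm y x] at h2
    simp only [Finset.mem_insert, true_or, Finset.insert_eq_of_mem] at h2
    omega

lemma tri_of_mem {x y : V} {f : Finset V} (hf : f ∈ F) (h : (x, y) ∈ orientedEdges (o f)) :
    ∃ w, Tri F o x y w ∧ f = {x, y, w} := by
  have h1 := H.face_eq f hf
  rcases ho : o f with ⟨p, q, r⟩
  rw [ho] at h h1
  simp only [orientedEdges, Finset.mem_insert, Finset.mem_singleton, Prod.mk.injEq] at h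
  rcases h with ⟨rfl, rfl⟩ | ⟨rfl, rfl⟩ | ⟨rfl, rfl⟩
  · exact ⟨r, ⟨f, hf, .inl ho⟩, h1.symm⟩
  · refine ⟨p, ⟨f, hf, .inr (.inr ho)⟩, h1.symm.trans ?_⟩
    ext z; simp; tauto
  · refine ⟨q, ⟨f, hf, .inr (.inl ho)⟩, h1.symm.trans ?_⟩
    ext z; simp; tauto

omit H in
lemma mem_of_tri {x y w : V} (h : Tri F o x y w) :
    ∃ f ∈ F, (x, y) ∈ orientedEdges (o f) ∧
      (o f = (x, y, w) ∨ o f = (y, w, x) ∨ o f = (w, x, y)) := by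
  obtain ⟨f, hf, h⟩ := h
  refine ⟨f, hf, ?_, h⟩
  rcases h with h | h | h <;> rw [h] <;> simp [orientedEdges]

lemma tri_unique {x y w w' : V} (h : Tri F o x y w) (h' : Tri F o x y w') : w = w' := by
  have n1 := H.tri_ne h
  have n2 := H.tri_ne h'
  obtain ⟨f, hf, hm, h⟩ := mem_of_tri h
  obtain ⟨g, hg, hm', h'⟩ := mem_of_tri h'
  have : f = g := by
    by_contra hne
    exact H.disj f hf g hg hne _ hm hm'
  subst this
  rcases h with h | h | h <;> rw [h] at h' <;> simp only [Prod.mk.injEq] at h' <;> grind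

lemma exists_tri_of_mem_face {x y : V} {f : Finset V} (hf : f ∈ F) (hx : x ∈ f) (hy : y ∈ f)
    (hxy : x ≠ y) : (x, y) ∈ orientedEdges (o f) ∨ (y, x) ∈ orientedEdges (o f) := by
  have h1 := H.face_eq f hf
  rw [← h1] at hx hy
  rcases ho : o f with ⟨p, q, r⟩
  rw [ho] at hx hy
  simp only [orientedEdges, Finset.mem_insert, Finset.mem_singleton, Prod.mk.injEq] at *
  grind

lemma tri_swap {x y w : V} (h : Tri F o x y w) : ∃ u, Tri F o y x u := by
  have n1 := H.tri_ne h
  obtain ⟨f, hf, hm, -⟩ := mem_of_tri h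
  obtain ⟨w', -, hfe⟩ := H.tri_of_mem hf hm
  have hxf : x ∈ f := by simp [hfe]
  have hyf : y ∈ f := by simp [hfe]
  have he := pair_mem_edges hf hxf hyf n1.1
  have h2 := H.card_star _ he
  obtain ⟨g, hg, hne⟩ := Finset.exists_mem_ne
    (s := F.filter (fun f => ({x, y} : Finset V) ⊆ f)) (by omega) f
  rw [Finset.mem_filter, Finset.insert_subset_iff, Finset.singleton_subset_iff] at hg
  obtain ⟨hgF, hxg, hyg⟩ := hg
  rcases H.exists_tri_of_mem_face hgF hxg hyg n1.1 with h3 | h3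
  · exact absurd h3 (H.disj f hf g hgF hne.symm _ hm)
  · obtain ⟨u, hu, -⟩ := H.tri_of_mem hgF h3
    exact ⟨u, hu⟩

lemma tri_of_edge {x y : V} (h : ({x, y} : Finset V) ∈ edges F) (hxy : x ≠ y) :
    ∃ w, Tri F o x y w := by
  rw [edges, Finset.mem_biUnion] at h
  obtain ⟨f, hf, h⟩ := h
  rw [Finset.mem_powersetCard, Finset.insert_subset_iff, Finset.singleton_subset_iff] at h
  rcases H.exists_tri_of_mem_face hf h.1.1 h.1.2 hxy with h3 | h3
  · obtain ⟨u, hu, -⟩ := H.tri_of_mem hf h3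
    exact ⟨u, hu⟩
  · obtain ⟨u, hu, -⟩ := H.tri_of_mem hf h3
    exact H.tri_swap hu

lemma tri_edge {x y w : V} (h : Tri F o x y w) : ({x, y} : Finset V) ∈ edges F :=
  pair_mem_edges (H.tri_face h) (by simp) (by simp) (H.tri_ne h).1

lemma tri_at {v : V} {f : Finset V} (hf : f ∈ F) (hv : v ∈ f) :
    ∃ y w, Tri F o v y w ∧ f = {v, y, w} := by
  have h1 := H.face_eq f hf
  rcases ho : o f with ⟨p, q, r⟩
  rw [ho] at h1
  rw [← h1] at hv
  simp only [Finset.mem_insert, Finset.mem_singleton] at hv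
  rcases hv with rfl | rfl | rfl
  · exact ⟨q, r, ⟨f, hf, .inl ho⟩, h1.symm⟩
  · refine ⟨r, p, ⟨f, hf, .inr (.inr ho)⟩, h1.symm.trans ?_⟩
    ext z; simp; tauto
  · refine ⟨p, q, ⟨f, hf, .inr (.inl ho)⟩, h1.symm.trans ?_⟩
    ext z; simp; tauto

/-- A face determines the cyclic order of its vertices. -/
lemma tri_inj {v y w y' w' : V} (h : Tri F o v y w) (h' : Tri F o v y' w')
    (he : ({v, y, w} : Finset V) = {v, y', w'}) : y = y' ∧ w = w' := by
  have n1 := H.tri_ne h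
  have n2 := H.tri_ne h'
  have key : ∀ {x y w f}, f ∈ F → (o f = (x, y, w) ∨ o f = (y, w, x) ∨ o f = (w, x, y)) →
      f = {x, y, w} := by
    intro x y w f hf h
    rw [← H.face_eq f hf]
    rcases h with h | h | h <;> rw [h] <;> ext z <;> simp <;> tauto
  obtain ⟨f, hf, h⟩ := h
  obtain ⟨g, hg, h'⟩ := h'
  have : f = g := by rw [key hf h, key hg h', he]
  subst this
  rcases h with h | h | h <;> rw [h] at h' <;> simp only [Prod.mk.injEq] at h' <;> grind

end Oriented

end Fisk

namespace Fisk

variable {V : Type*} [DecidableEq V] {F : Finset (Finset V)} {o : Finset V → V × V × V}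

variable (F o) in
/-- The oriented edges of an oriented triangulation. -/
def darts : Finset (V × V) := F.biUnion fun f => orientedEdges (o f)

lemma Tri.mem_darts {x y w : V} (h : Tri F o x y w) : (x, y) ∈ darts F o := by
  obtain ⟨f, hf, hm, -⟩ := Oriented.mem_of_tri h
  exact Finset.mem_biUnion.2 ⟨f, hf, hm⟩

lemma mem_vertices_iff {v : V} : v ∈ vertices F ↔ ∃ f ∈ F, v ∈ f := by
  simp [vertices, Finset.mem_sup]

namespace Oriented

lemma exists_third (H : Oriented F o) (d : darts F o) : ∃ w, Tri F o d.1.1 d.1.2 w := by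
  obtain ⟨f, hf, hm⟩ := Finset.mem_biUnion.1 d.2
  obtain ⟨w, hw, -⟩ := H.tri_of_mem hf hm
  exact ⟨w, hw⟩

/-- The third vertex of the face to the left of a dart. -/
noncomputable def third (H : Oriented F o) (d : darts F o) : V := (H.exists_third d).choose

variable (H : Oriented F o)
include H

lemma tri_third (d : darts F o) : Tri F o d.1.1 d.1.2 (H.third d) := (H.exists_third d).choose_spec

lemma third_eq {d : darts F o} {w : V} (h : Tri F o d.1.1 d.1.2 w) : H.third d = w :=
  H.tri_unique (H.tri_third d) h

/-- The opposite dart. -/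
def rev (d : darts F o) : darts F o :=
  ⟨(d.1.2, d.1.1), (H.tri_swap (H.tri_third d)).choose_spec.mem_darts⟩

/-- The next dart along the face to the left. -/
noncomputable def faceNext (d : darts F o) : darts F o :=
  ⟨(d.1.2, H.third d), (H.tri_third d).rot.mem_darts⟩

/-- The rotation about the tail of a dart. -/
noncomputable def rot : Equiv.Perm (darts F o) where
  toFun d := ⟨(d.1.1, H.third d),
    (H.tri_swap (H.tri_third d).rot.rot).choose_spec.mem_darts⟩
  invFun d := ⟨(d.1.1, H.third (H.rev d)), (H.tri_third (H.rev d)).rot.mem_darts⟩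
  left_inv d := by
    ext
    · rfl
    · exact H.third_eq (H.tri_third d).rot.rot
  right_inv d := by
    ext
    · rfl
    · exact H.third_eq (H.tri_third (H.rev d)).rot

lemma rev_rev (d : darts F o) : H.rev (H.rev d) = d := rfl

lemma third_faceNext (d : darts F o) : H.third (H.faceNext d) = d.1.1 :=
  H.third_eq (H.tri_third d).rot

lemma faceNext_faceNext_faceNext (d : darts F o) :
    H.faceNext (H.faceNext (H.faceNext d)) = d := by
  have h := H.third_faceNext d
  ext
  · exact h
  · exact H.third_faceNext (H.faceNext d)

lemma symm_rot_rev (d : darts F o) : H.rot.symm (H.rev d) = H.faceNext d := rfl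

lemma rev_rot (d : darts F o) : H.rev (H.rot d) = H.faceNext (H.faceNext d) := by
  ext
  · rfl
  · exact (H.third_faceNext d).symm

lemma rot_ne (d : darts F o) : H.rot d ≠ d := by
  intro h
  have h2 : H.third d = d.1.2 := congrArg (fun d => d.1.2) h
  exact (H.tri_ne (H.tri_third d)).2.1 h2.symm

lemma fst_mem_vertices (d : darts F o) : d.1.1 ∈ vertices F :=
  mem_vertices_iff.2 ⟨_, H.tri_face (H.tri_third d), by simp⟩

lemma mem_darts_of_mem_face {x y : V} {f : Finset V} (hf : f ∈ F) (hx : x ∈ f) (hy : y ∈ f)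
    (hxy : x ≠ y) : (x, y) ∈ darts F o :=
  (H.tri_of_edge (pair_mem_edges hf hx hy hxy) hxy).choose_spec.mem_darts

lemma exists_dart {v : V} (hv : v ∈ vertices F) : ∃ d : darts F o, d.1.1 = v := by
  obtain ⟨f, hf, hv⟩ := mem_vertices_iff.1 hv
  obtain ⟨y, w, h, -⟩ := H.tri_at hf hv
  exact ⟨⟨_, h.mem_darts⟩, rfl⟩

/-- The rotation is transitive on the darts at a vertex. -/
lemma sameCycle_rot (hL : LinkConnected F) {d e : darts F o} (h : d.1.1 = e.1.1) :
    H.rot.SameCycle d e := by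
  obtain ⟨v, hv⟩ : ∃ v, v = d.1.1 := ⟨_, rfl⟩
  have key : ∀ g, Relation.ReflTransGen
      (fun x y => x ∈ F ∧ y ∈ F ∧ v ∈ x ∧ v ∈ y ∧ (x ∩ y).card = 2)
      {d.1.1, d.1.2, H.third d} g →
      ∀ e : darts F o, e.1.1 = v → g = {e.1.1, e.1.2, H.third e} → H.rot.SameCycle d e := by
    intro g hg
    induction hg with
    | refl =>
      intro e he hge
      have h1 := H.tri_third d
      have h2 := H.tri_third e
      rw [he, hv] at h2 hge
      have : e = d := by
        ext
        · rw [he, hv]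
        · exact (H.tri_inj h1 h2 hge).1.symm
      rw [this]
    | @tail p q _ hpq ih =>
      intro e he hge
      obtain ⟨hp, -, hvp, -, hc⟩ := hpq
      obtain ⟨y, w, ht, hpe⟩ := H.tri_at hp hvp
      have hy : H.third ⟨(v, y), ht.mem_darts⟩ = w := H.third_eq ht
      have h1 := ih ⟨(v, y), ht.mem_darts⟩ rfl (by rw [hy]; exact hpe)
      refine h1.trans ?_
      obtain ⟨z, hz, hzv⟩ := Finset.exists_mem_ne (s := p ∩ q) (by omega) v
      have h2 := H.tri_third e
      have hrot : ∀ {y w} (h : Tri F o v y w) (h' : (v, w) ∈ darts F o),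
          H.rot ⟨(v, y), h.mem_darts⟩ = ⟨(v, w), h'⟩ := by
        intro y w h h'
        ext
        · rfl
        · exact H.third_eq h
      obtain ⟨⟨e1, e2⟩, he'⟩ := e
      obtain ⟨w', hw'⟩ : ∃ w', w' = H.third ⟨(e1, e2), he'⟩ := ⟨_, rfl⟩
      rw [← hw'] at h2 hge
      obtain rfl : e1 = v := he
      rw [hge, hpe] at hz
      simp only [Finset.mem_inter, Finset.mem_insert, Finset.mem_singleton, hzv, false_or] at hz
      obtain ⟨rfl | rfl, h3 | h3⟩ := hz
      · subst h3; exact .refl _ _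
      · refine Equiv.Perm.SameCycle.symm ⟨1, ?_⟩
        subst h3
        simpa using hrot h2 _
      · refine ⟨1, ?_⟩
        subst h3
        simpa using hrot ht _
      · have h4 : y = e2 := H.tri_unique ht.rot.rot (h3 ▸ h2.rot.rot)
        subst h4; exact .refl _ _
  have hd := H.tri_third d
  have he := H.tri_third e
  refine key _ (hL v _ (H.tri_face hd) _ (H.tri_face he) ?_ ?_) e (by rw [hv, h]) rfl
  · simp [hv]
  · simp [hv, h]

lemma exists_iterate_rot (hL : LinkConnected F) {d e : darts F o} (h : d.1.1 = e.1.1) :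
    ∃ k : ℕ, H.rot^[k] d = e := by
  obtain ⟨k, -, hk⟩ := (H.sameCycle_rot hL h).exists_pow_eq'
  exact ⟨k, by rw [← hk, Equiv.Perm.iterate_eq_pow]⟩

lemma pair_mem_edges_of_dart (d : darts F o) : ({d.1.1, d.1.2} : Finset V) ∈ edges F :=
  H.tri_edge (H.tri_third d)

/-- Every edge underlies a dart. -/
lemma exists_dart_of_edge {e : Finset V} (he : e ∈ edges F) :
    ∃ d : darts F o, e = {d.1.1, d.1.2} := by
  obtain ⟨f, hf, hfe⟩ := Finset.mem_biUnion.1 he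
  obtain ⟨x, y, hxy, rfl⟩ := Finset.card_eq_two.1 (Finset.mem_powersetCard.1 hfe).2
  exact ⟨⟨_, (H.tri_of_edge he hxy).choose_spec.mem_darts⟩, rfl⟩

lemma degree_eq (v : V) :
    degree F v = (Finset.univ.filter fun d : darts F o => d.1.1 = v).card := by
  symm
  refine Finset.card_bij (fun d _ => {d.1.1, d.1.2}) ?_ ?_ ?_
  · intro d hd
    rw [Finset.mem_filter] at hd ⊢
    exact ⟨H.pair_mem_edges_of_dart d, by simp [hd.2]⟩
  · intro d hd e he h
    have hd := (Finset.mem_filter.1 hd).2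
    have he := (Finset.mem_filter.1 he).2
    have n1 := (H.tri_ne (H.tri_third d)).1
    have n2 := (H.tri_ne (H.tri_third e)).1
    rw [hd] at n1 h
    rw [he] at n2 h
    have h3 : d.1.2 ∈ ({v, e.1.2} : Finset V) := h ▸ by simp
    ext
    · rw [hd, he]
    · simpa [n1.symm] using h3
  · intro e he
    rw [Finset.mem_filter] at he
    obtain ⟨d, rfl⟩ := H.exists_dart_of_edge he.1
    have := he.2
    simp only [Finset.mem_insert, Finset.mem_singleton] at this
    rcases this with rfl | rfl
    · exact ⟨d, by simp, rfl⟩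
    · exact ⟨H.rev d, by simp [rev], Finset.pair_comm _ _⟩

lemma iterate_degree_rot (hL : LinkConnected F) (d : darts F o) :
    H.rot^[degree F d.1.1] d = d := by
  rw [Equiv.Perm.iterate_eq_pow, H.degree_eq]
  refine Equiv.Perm.IsCycleOn.pow_card_apply ⟨?_, ?_⟩ (by simp)
  · refine ⟨fun e he => ?_, H.rot.injective.injOn, fun e he => ⟨H.rot.symm e, ?_, by simp⟩⟩
    · simpa [rot] using he
    · simpa [rot] using he
  · intro x hx y hy
    simp only [Finset.coe_filter, Finset.mem_univ, true_and, Set.mem_ofPred_eq] at hx hy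
    exact H.sameCycle_rot hL (hx.trans hy.symm)

lemma card_darts : (darts F o).card = 3 * F.card := by
  rw [darts, Finset.card_biUnion, Finset.sum_const_nat (m := 3), mul_comm]
  · intro f hf
    have h1 := H.face_eq f hf
    have h2 := H.card_face f hf
    rcases ho : o f with ⟨p, q, r⟩
    have n := H.tri_ne (⟨f, hf, .inl ho⟩ : Tri F o p q r)
    rw [orientedEdges, Finset.card_eq_three]
    exact ⟨_, _, _, by grind, by grind, by grind, rfl⟩
  · intro f hf g hg hfg
    exact Finset.disjoint_left.2 (H.disj f hf g hg hfg)

lemma sum_degree : ∑ v ∈ vertices F, degree F v = 3 * F.card := by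
  rw [← H.card_darts, ← Fintype.card_coe, ← Finset.card_univ,
    Finset.card_eq_sum_card_fiberwise (f := fun d : darts F o => d.1.1) (t := vertices F)]
  · exact Finset.sum_congr rfl fun v _ => H.degree_eq v
  · exact fun d _ => H.fst_mem_vertices d

lemma connected (hF : FacesConnected F) (U : Set V)
    (hU : ∀ d : darts F o, d.1.1 ∈ U → d.1.2 ∈ U) (d e : darts F o) (hd : d.1.1 ∈ U) :
    e.1.1 ∈ U := by
  have face : ∀ f ∈ F, ∀ x ∈ f, x ∈ U → ∀ y ∈ f, y ∈ U := by
    intro f hf x hx hxU y hy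
    by_cases hxy : x = y
    · rwa [← hxy]
    · exact hU ⟨_, H.mem_darts_of_mem_face hf hx hy hxy⟩ hxU
  have h1 := H.tri_face (H.tri_third d)
  have key : ∀ g, Relation.ReflTransGen (fun x y => x ∈ F ∧ y ∈ F ∧ (x ∩ y).card = 2)
      {d.1.1, d.1.2, H.third d} g → ∀ y ∈ g, y ∈ U := by
    intro g hg
    induction hg with
    | refl => exact face _ h1 _ (by simp) hd
    | @tail p q _ hpq ih =>
      obtain ⟨-, hq, hc⟩ := hpq
      obtain ⟨z, hz⟩ := Finset.card_pos.1 (by omega : 0 < (p ∩ q).card)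
      rw [Finset.mem_inter] at hz
      exact face _ hq z hz.2 (ih z hz.1)
  exact key _ (hF _ h1 _ (H.tri_face (H.tri_third e))) _ (by simp)

end Oriented

end Fisk

namespace Fisk

variable {V : Type*} [DecidableEq V] {F : Finset (Finset V)} {o : Finset V → V × V × V}

/-- With the degrees `5`, `7`, `6, 6, …` there are twice as many faces as vertices. -/
lemma Oriented.card_eq_two_mul (H : Oriented F o) {a b : V} (ha : a ∈ vertices F)
    (hb : b ∈ vertices F) (hab : a ≠ b) (h5 : degree F a = 5) (h7 : degree F b = 7)
    (h6 : ∀ v ∈ vertices F, v ≠ a → v ≠ b → degree F v = 6) :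
    F.card = 2 * (vertices F).card := by
  have h := H.sum_degree
  have hb' : b ∈ (vertices F).erase a := Finset.mem_erase.2 ⟨hab.symm, hb⟩
  rw [← Finset.add_sum_erase _ _ ha, ← Finset.add_sum_erase _ _ hb',
    Finset.sum_const_nat (m := 6), h5, h7] at h
  · have h1 := Finset.card_erase_add_one ha
    have h2 := Finset.card_erase_add_one hb'
    omega
  · intro v hv
    simp only [Finset.mem_erase] at hv
    exact h6 v hv.2.2 hv.2.1 hv.1

lemma Oriented.exists_form (H : Oriented F o) (hne : (vertices F).Nonempty)
    (hcard : (vertices F).card + ((edges F).card + F.card) ≤ 3 * F.card) :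
    ∃ f : darts F o → ℝ, (∀ d, f (H.rev d) = - f d) ∧
      (∀ d, f d + f (H.faceNext d) + f (H.faceNext (H.faceNext d)) = 0) ∧ (∀ d, f d ≤ 1) ∧
      ∃ v, Relation.TransGen (fun v w : vertices F => ∃ d : darts F o,
        (⟨d.1.1, H.fst_mem_vertices d⟩ : vertices F) = v ∧
        ⟨(H.rev d).1.1, H.fst_mem_vertices (H.rev d)⟩ = w ∧ f d = 1) v v := by
  have : Nonempty (vertices F) := hne.to_subtype
  choose s hs using fun e : edges F => H.exists_dart_of_edge e.2
  let t : F → darts F o := fun f => ⟨((o f).1, (o f).2.1),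
    Finset.mem_biUnion.2 ⟨f, f.2, by simp [orientedEdges]⟩⟩
  refine exists_tight_form H.rev H.faceNext
    (fun d => (⟨d.1.1, H.fst_mem_vertices d⟩ : vertices F)) s
    t H.rev_rev H.faceNext_faceNext_faceNext (fun _ => rfl) ?_ ?_ ?_
  · intro d
    refine ⟨⟨_, H.pair_mem_edges_of_dart d⟩, ?_⟩
    have h := hs ⟨_, H.pair_mem_edges_of_dart d⟩
    set e := s ⟨_, H.pair_mem_edges_of_dart d⟩
    have h1 : d.1.1 ∈ ({e.1.1, e.1.2} : Finset V) := h ▸ by simp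
    have h2 : d.1.2 ∈ ({e.1.1, e.1.2} : Finset V) := h ▸ by simp
    have n1 := (H.tri_ne (H.tri_third d)).1
    simp only [Finset.mem_insert, Finset.mem_singleton] at h1 h2
    rcases h1 with h1 | h1 <;> rcases h2 with h2 | h2
    · exact absurd (h1.trans h2.symm) n1
    · exact .inl (Subtype.ext (Prod.ext h1 h2))
    · exact .inr (Subtype.ext (Prod.ext h1 h2))
    · exact absurd (h1.trans h2.symm) n1
  · intro d
    obtain ⟨f, hf, h⟩ := H.tri_third d
    refine ⟨⟨f, hf⟩, ?_⟩
    rcases h with h | h | h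
    · refine .inl (Subtype.ext ?_)
      simp [t, h]
    · have h1 : t ⟨f, hf⟩ = H.faceNext d := Subtype.ext (by simp [t, h, Oriented.faceNext])
      exact .inr (.inr (by rw [h1, H.faceNext_faceNext_faceNext]))
    · have h1 : t ⟨f, hf⟩ = H.faceNext (H.faceNext d) := by
        refine Subtype.ext (Prod.ext ?_ ?_)
        · simp [t, h, Oriented.faceNext]
        · exact (congrArg (fun p => p.2.1) h).trans (H.third_faceNext d).symm
      exact .inr (.inl (by rw [h1, H.faceNext_faceNext_faceNext]))
  · simp only [Fintype.card_coe, H.card_darts]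
    exact hcard

end Fisk

open Fisk in
/-- (Jendroľ–Jucovič) There is no triangulation of the torus in which all
vertices have degree 6 except exactly two, one of degree 5 and one of
degree 7. -/
theorem no_torus_five_seven {V : Type*} [DecidableEq V] :
    ¬ ∃ (F : Finset (Finset V)) (a b : V),
        IsTorus F ∧ a ∈ vertices F ∧ b ∈ vertices F ∧ a ≠ b ∧
        degree F a = 5 ∧ degree F b = 7 ∧
        (∀ v ∈ vertices F, v ≠ a → v ≠ b → degree F v = 6) := by
  rintro ⟨F, a, b, ⟨⟨-, hc, hs, hL⟩, hF, ⟨o, ho, hd⟩, hχ⟩, ha, hb, hab, h5, h7, h6⟩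
  have H : Oriented F o := ⟨hc, hs, ho, hd⟩
  have h2 := H.card_eq_two_mul ha hb hab h5 h7 h6
  obtain ⟨f, f_rev, f_face, f_le, v, hv⟩ := H.exists_form ⟨a, ha⟩ (by
    rw [eulerChar] at hχ
    omega)
  let M : TightMap (darts F o) (vertices F) :=
    { σ := H.rot
      ρ := H.rev
      tl := fun d => ⟨d.1.1, H.fst_mem_vertices d⟩
      f := f
      a := ⟨a, ha⟩
      b := ⟨b, hb⟩
      rev_rev := H.rev_rev
      triangle := fun x => by
        rw [H.rev_rot, H.rev_rot, H.rev_rot, H.faceNext_faceNext_faceNext,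
          H.faceNext_faceNext_faceNext]
      tl_rot := fun _ => rfl
      rot_ne := H.rot_ne
      f_rev := f_rev
      f_rot := fun x => by
        have h := f_face x
        rw [← H.rev_rot, f_rev] at h
        rw [H.symm_rot_rev]
        linarith
      f_le := f_le
      a_ne_b := fun h => hab (congrArg Subtype.val h)
      reg := fun x hxa hxb => by
        have h := H.iterate_degree_rot hL x
        rwa [h6 _ (H.fst_mem_vertices x) (fun h => hxa (Subtype.ext h))
          (fun h => hxb (Subtype.ext h))] at h
      deg_a := fun x hx => by
        have h := H.iterate_degree_rot hL x
        rwa [show x.1.1 = a from congrArg Subtype.val hx, h5] at h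
      deg_b := fun x hx => by
        have h := H.iterate_degree_rot hL x
        rwa [show x.1.1 = b from congrArg Subtype.val hx, h7] at h
      transitive := fun x y h => H.exists_iterate_rot hL (congrArg Subtype.val h)
      connected := fun U hU d e hdU => by
        have h := H.connected hF (Subtype.val '' U) (fun d hd => ?_) d e ⟨_, hdU, rfl⟩
        · obtain ⟨w, hw, h⟩ := h
          rwa [← show w = ⟨e.1.1, H.fst_mem_vertices e⟩ from Subtype.ext h]
        · obtain ⟨w, hw, h⟩ := hd
          refine ⟨_, hU d ?_, rfl⟩
          rwa [← show w = ⟨d.1.1, H.fst_mem_vertices d⟩ from Subtype.ext h]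
      exists_b := by
        obtain ⟨d, hd⟩ := H.exists_dart hb
        exact ⟨d, Subtype.ext hd⟩ }
  refine TightMap.not_walk (M := M) ⟨v, ?_⟩
  have key : ∀ w, Relation.TransGen (fun v w => ∃ d, M.tl d = v ∧ M.tl (M.ρ d) = w ∧ M.f d = 1)
      v w → ∃ n, 0 < n ∧ M.Walk v w n := by
    intro w h
    induction h with
    | single h =>
      obtain ⟨d, rfl, rfl, h⟩ := h
      exact ⟨1, one_pos, .single d h⟩
    | tail _ h ih =>
      obtain ⟨n, hn, ih⟩ := ih
      obtain ⟨d, rfl, rfl, h⟩ := h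
      exact ⟨n + 1, n.succ_pos, ih.trans (.single d h)⟩
  exact key v hv
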